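/- arXiv:math/0405370 — 3 statements merged into one kernel-verified Lean document; each statement's English description precedes it below -/
import Mathlib

section
/- Let n ≥ 2 and let 2 ≤ r ≤ 2n/(n−2) (with 2 ≤ r < ∞ when n = 2), and set δ(r) := n(1/2 − 1/r). There exists a constant C_r, depending only on n and r, such that for every ε ∈ (0,1], every t ∈ ℝ, and every φ : ℝⁿ → ℂ in the Schwartz class: (i) ‖φ‖_{L^r} ≤ C_r |cos t|^{−δ(r)} ‖φ‖_{L²}^{1−δ(r)} ‖J^ε(t)φ‖_{L²}^{δ(r)}, and (ii) ‖φ‖_{L^r} ≤ C_r (ε|sin t|)^{−δ(r)} ‖φ‖_{L²}^{1−δ(r)} ‖H^ε(t)φ‖_{L²}^{δ(r)} (each inequality read as trivially true when the right-hand side is infinite or when cos t = 0, resp. sin t = 0). -/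
open MeasureTheory Real Filter Topology
open scoped ENNReal NNReal ComplexConjugate

noncomputable section

/-- Euclidean space ℝⁿ. -/
abbrev Rn (n : ℕ) := EuclideanSpace ℝ (Fin n)

/-- The gradient of a complex-valued function on ℝⁿ, as a ℂⁿ-valued function. -/
def grad {n : ℕ} (φ : Rn n → ℂ) (x : Rn n) : Fin n → ℂ :=
  fun j => fderiv ℝ φ x (EuclideanSpace.single j 1)

/-- The gradient, valued in the Euclidean space ℂⁿ (so that its pointwise norm is the
Euclidean norm). -/
def gradE {n : ℕ} (φ : Rn n → ℂ) (x : Rn n) : EuclideanSpace ℂ (Fin n) :=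
  (WithLp.equiv 2 (Fin n → ℂ)).symm (grad φ x)

/-- The Laplacian of a complex-valued function on ℝⁿ. -/
def lap {n : ℕ} (φ : Rn n → ℂ) (x : Rn n) : ℂ :=
  ∑ j, fderiv ℝ (fun y => fderiv ℝ φ y (EuclideanSpace.single j 1)) x (EuclideanSpace.single j 1)

/-- The operator J^ε(t) = (x/ε) sin t − i cos t ∇ₓ. -/
def Jop {n : ℕ} (ε t : ℝ) (φ : Rn n → ℂ) (x : Rn n) : Fin n → ℂ :=
  fun j => ((x j / ε : ℝ) : ℂ) * ((Real.sin t : ℝ) : ℂ) * φ x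
    - Complex.I * ((Real.cos t : ℝ) : ℂ) * grad φ x j

/-- The operator H^ε(t) = x cos t + iε sin t ∇ₓ. -/
def Hop {n : ℕ} (ε t : ℝ) (φ : Rn n → ℂ) (x : Rn n) : Fin n → ℂ :=
  fun j => ((x j : ℝ) : ℂ) * ((Real.cos t : ℝ) : ℂ) * φ x
    + Complex.I * (ε : ℂ) * ((Real.sin t : ℝ) : ℂ) * grad φ x j

/-- J^ε(t)φ viewed as valued in Euclidean ℂⁿ. -/
def JopE {n : ℕ} (ε t : ℝ) (φ : Rn n → ℂ) (x : Rn n) : EuclideanSpace ℂ (Fin n) :=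
  (WithLp.equiv 2 (Fin n → ℂ)).symm (Jop ε t φ x)

/-- H^ε(t)φ viewed as valued in Euclidean ℂⁿ. -/
def HopE {n : ℕ} (ε t : ℝ) (φ : Rn n → ℂ) (x : Rn n) : EuclideanSpace ℂ (Fin n) :=
  (WithLp.equiv 2 (Fin n → ℂ)).symm (Hop ε t φ x)

/-- Convolution (|x|^{−γ} ∗ ψ)(x) of a real-valued ψ with the kernel |x|^{−γ}. -/
def conv {n : ℕ} (γ : ℝ) (ψ : Rn n → ℝ) (x : Rn n) : ℝ :=
  ∫ y : Rn n, ‖x - y‖ ^ (-γ) * ψ y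

/-- Convolution (|x|^{−γ} ∗ ψ)(x) of a complex-valued ψ with the kernel |x|^{−γ}. -/
def convC {n : ℕ} (γ : ℝ) (ψ : Rn n → ℂ) (x : Rn n) : ℂ :=
  ∫ y : Rn n, ((‖x - y‖ ^ (-γ) : ℝ) : ℂ) * ψ y

/-- The Hartree potential |x|^{−γ} ∗ |u|². -/
def hartree {n : ℕ} (γ : ℝ) (u : Rn n → ℂ) (x : Rn n) : ℝ :=
  conv γ (fun y => Complex.normSq (u y)) x

/-- `u` is a (smooth, Schwartz-in-x) solution of the semiclassical Hartree equation with
harmonic potential: iε∂ₜu + (ε²/2)Δu = (|x|²/2)u + ε^α(|x|^{−γ}∗|u|²)u, u(0) = f. -/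
structure IsSolutionH (n : ℕ) (α γ ε : ℝ) (f : Rn n → ℂ) (u : ℝ → Rn n → ℂ) : Prop where
  smooth : ContDiff ℝ (⊤ : ℕ∞) (fun p : ℝ × Rn n => u p.1 p.2)
  schwartz : ∀ t, ∃ φ : SchwartzMap (Rn n) ℂ, u t = ⇑φ
  init : u 0 = f
  eq : ∀ t x, Complex.I * (ε : ℂ) * deriv (fun s => u s x) t
      + ((ε ^ 2 / 2 : ℝ) : ℂ) * lap (u t) x
    = ((‖x‖ ^ 2 / 2 : ℝ) : ℂ) * u t x
      + ((ε ^ α : ℝ) : ℂ) * ((hartree γ (u t) x : ℝ) : ℂ) * u t x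

/-- `u` is a (smooth, Schwartz-in-x) solution of the linear equation
iε∂ₜu + (ε²/2)Δu = (|x|²/2)u. -/
structure IsLinSol (n : ℕ) (ε : ℝ) (u : ℝ → Rn n → ℂ) : Prop where
  smooth : ContDiff ℝ (⊤ : ℕ∞) (fun p : ℝ × Rn n => u p.1 p.2)
  schwartz : ∀ t, ∃ φ : SchwartzMap (Rn n) ℂ, u t = ⇑φ
  eq : ∀ t x, Complex.I * (ε : ℂ) * deriv (fun s => u s x) t
      + ((ε ^ 2 / 2 : ℝ) : ℂ) * lap (u t) x
    = ((‖x‖ ^ 2 / 2 : ℝ) : ℂ) * u t x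

/-- The semiclassical harmonic-oscillator propagator U^ε(t), via Mehler's formula
(for 0 < t < π). -/
def Uprop (n : ℕ) (ε t : ℝ) (φ : Rn n → ℂ) (x : Rn n) : ℂ :=
  Complex.exp (-Complex.I * (n : ℂ) * (π : ℂ) / 4) *
    ((2 * π * ε * Real.sin t : ℝ) : ℂ) ^ (-(n : ℂ) / 2) *
    ∫ y : Rn n, Complex.exp ((Complex.I / ((ε * Real.sin t : ℝ) : ℂ)) *
      (((‖x‖ ^ 2 + ‖y‖ ^ 2) / 2 * Real.cos t - ∑ j, x j * y j : ℝ) : ℂ)) * φ y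

/-- The WKB approximation operator V^ε(t) (for t ∈ (0,π/2) ∪ (π/2,π)). -/
def Vprop (n : ℕ) (ε t : ℝ) (φ : Rn n → ℂ) (x : Rn n) : ℂ :=
  if t < π / 2 then
    ((Real.cos t ^ (-(n : ℝ) / 2) : ℝ) : ℂ) * φ ((Real.cos t)⁻¹ • x) *
      Complex.exp (-Complex.I * ((‖x‖ ^ 2 * Real.tan t / (2 * ε) : ℝ) : ℂ))
  else
    Complex.exp (-Complex.I * (n : ℂ) * ((π / 2 : ℝ) : ℂ)) *
      ((|Real.cos t| ^ (-(n : ℝ) / 2) : ℝ) : ℂ) * φ ((Real.cos t)⁻¹ • x) *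
      Complex.exp (-Complex.I * ((‖x‖ ^ 2 * Real.tan t / (2 * ε) : ℝ) : ℂ))

/-- The Σ-norm ‖φ‖_Σ = ‖φ‖_{L²} + ‖|x|φ‖_{L²} + ‖∇φ‖_{L²}, with values in ℝ≥0∞. -/
def SigmaNorm {n : ℕ} (φ : Rn n → ℂ) : ℝ≥0∞ :=
  eLpNorm φ 2 volume + eLpNorm (fun x => (‖x‖ : ℂ) * φ x) 2 volume
    + eLpNorm (gradE φ) 2 volume

/-- The H¹-norm (‖φ‖_{L²}² + ‖∇φ‖_{L²}²)^{1/2}, with values in ℝ≥0∞. -/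
def H1norm {n : ℕ} (φ : Rn n → ℂ) : ℝ≥0∞ :=
  (eLpNorm φ 2 volume ^ (2 : ℝ) + eLpNorm (gradE φ) 2 volume ^ (2 : ℝ)) ^ ((1 : ℝ) / 2)

/-- The nonlinear WKB phase g(t,x) = −(|x|^{−γ}∗|f|²)(x) ∫₀ᵗ |cos τ|^{−γ} dτ. -/
def gphase {n : ℕ} (γ : ℝ) (f : Rn n → ℂ) (t : ℝ) (x : Rn n) : ℝ :=
  -(conv γ (fun y => Complex.normSq (f y)) x) * ∫ τ in (0 : ℝ)..t, |Real.cos τ| ^ (-γ)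

/-- The Fourier transform Fφ(ξ) = (2π)^{−n/2} ∫ e^{−ix·ξ} φ(x) dx. -/
def FT {n : ℕ} (φ : Rn n → ℂ) (ξ : Rn n) : ℂ :=
  (((2 * π : ℝ) ^ (-(n : ℝ) / 2) : ℝ) : ℂ) *
    ∫ x : Rn n, Complex.exp (-Complex.I * ((∑ j, x j * ξ j : ℝ) : ℂ)) * φ x

/-- The inverse Fourier transform. -/
def FTinv {n : ℕ} (φ : Rn n → ℂ) (ξ : Rn n) : ℂ :=
  (((2 * π : ℝ) ^ (-(n : ℝ) / 2) : ℝ) : ℂ) *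
    ∫ x : Rn n, Complex.exp (Complex.I * ((∑ j, x j * ξ j : ℝ) : ℂ)) * φ x

/-- Log-convexity of the Lebesgue norms. -/
lemma gn_interp {α : Type*} [MeasurableSpace α] {μ : Measure α} {f : α → ℝ≥0∞}
    (hf : AEMeasurable f μ) {r q θ : ℝ} (hr : 0 < r) (hq : 0 < q) (h0 : 0 ≤ θ) (h1 : θ ≤ 1)
    (h : 1 / r = (1 - θ) / 2 + θ / q) :
    (∫⁻ x, f x ^ r ∂μ) ^ (1 / r) ≤
      ((∫⁻ x, f x ^ (2 : ℝ) ∂μ) ^ (1 / 2 : ℝ)) ^ (1 - θ) * ((∫⁻ x, f x ^ q ∂μ) ^ (1 / q)) ^ θ := by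
  have e : r * ((1 - θ) / 2) + r * (θ / q) = 1 := by
    rw [← mul_add, ← h]; field_simp
  have ha : 0 ≤ r * ((1 - θ) / 2) := by
    have : 0 ≤ 1 - θ := by linarith
    positivity
  have hb : 0 ≤ r * (θ / q) := by positivity
  have key := ENNReal.lintegral_mul_norm_pow_le (μ := μ) (hf.pow_const (2 : ℝ)) (hf.pow_const q)
    ha hb e
  have e2 : ∀ x, (f x ^ (2 : ℝ)) ^ (r * ((1 - θ) / 2)) * (f x ^ q) ^ (r * (θ / q)) = f x ^ r := by
    intro x
    rw [← ENNReal.rpow_mul, ← ENNReal.rpow_mul, ← ENNReal.rpow_add_of_nonneg _ _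
      (by positivity) (by positivity)]
    congr 1
    field_simp
    ring
  simp_rw [e2] at key
  calc _ ≤ _ := ENNReal.rpow_le_rpow key (by positivity : 0 ≤ 1 / r)
    _ = _ := by
      rw [ENNReal.mul_rpow_of_nonneg _ _ (by positivity)]
      simp_rw [← ENNReal.rpow_mul]
      congr 2 <;> field_simp

/-- Integer-exponent inequality in dimension two. -/
lemma gn_dim2 (k : ℕ) : ∃ C : ℝ≥0, ∀ u : Rn 2 → ℂ, ContDiff ℝ 1 u → HasCompactSupport u →
    ∫⁻ x, ‖u x‖ₑ ^ (2 * (k + 1)) ≤ C * (∫⁻ x, ‖u x‖ₑ ^ 2) * (∫⁻ x, ‖fderiv ℝ u x‖ₑ ^ 2) ^ k := by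
  induction k with
  | zero => exact ⟨1, fun u _ _ => by simp⟩
  | succ k ih =>
    obtain ⟨C, hC⟩ := ih
    refine ⟨lintegralPowLePowLIntegralFDerivConst (volume : Measure (Rn 2)) 2 * (k + 2) ^ 2 * C,
      fun u hu h2u => ?_⟩
    have hp : Real.HolderConjugate (Module.finrank ℝ (Rn 2)) 2 := by
      simp only [finrank_euclideanSpace, Fintype.card_fin]
      exact_mod_cast Real.HolderConjugate.two_two
    have h3 : HasCompactSupport (fun x => u x ^ (k + 2)) := by
      refine h2u.comp_left (g := fun z : ℂ => z ^ (k + 2)) (by simp)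
    have key := lintegral_pow_le_pow_lintegral_fderiv (volume : Measure (Rn 2))
      (u := fun x => u x ^ (k + 2)) (hu.pow _) h3 hp
    have hd : ∀ x, ‖fderiv ℝ (fun x => u x ^ (k + 2)) x‖ₑ
        ≤ ((k + 2 : ℝ≥0) : ℝ≥0∞) * (‖u x‖ₑ ^ (k + 1) * ‖fderiv ℝ u x‖ₑ) := by
      intro x
      have := ((hu.differentiable one_ne_zero x).hasFDerivAt.pow (k + 2)).fderiv
      have h5 : fderiv ℝ (fun x => u x ^ (k + 2)) x
        = ((k + 2 : ℕ) * u x ^ (k + 1)) • fderiv ℝ u x := by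
        rw [this]; simp
      rw [h5, enorm_smul, enorm_mul, enorm_pow, mul_assoc]
      refine le_of_eq ?_
      congr 1
      rw [enorm_eq_nnnorm, Complex.nnnorm_natCast]; push_cast; rfl
    have hm1 : AEMeasurable (fun x => ‖u x‖ₑ ^ (2 * (k + 1))) :=
      (hu.continuous.enorm.measurable.pow_const _).aemeasurable
    have hm2 : AEMeasurable (fun x => ‖fderiv ℝ u x‖ₑ ^ 2) :=
      ((hu.continuous_fderiv one_ne_zero).enorm.measurable.pow_const _).aemeasurable
    have cs := ENNReal.lintegral_mul_norm_pow_le hm1 hm2 (p := 1 / 2) (q := 1 / 2)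
      (by norm_num) (by norm_num) (by norm_num)
    have hsq : ∀ a : ℝ≥0∞, ∀ m : ℕ, (a ^ (2 * m)) ^ (1 / 2 : ℝ) = a ^ m := by
      intro a m
      rw [← ENNReal.rpow_natCast, ← ENNReal.rpow_mul, ← ENNReal.rpow_natCast]
      congr 1; push_cast; ring
    have hsq1 : ∀ a : ℝ≥0∞, (a ^ 2) ^ (1 / 2 : ℝ) = a := by
      intro a; simpa using hsq a 1
    have hsq2 : ∀ a : ℝ≥0∞, (a ^ (1 / 2 : ℝ)) ^ 2 = a := by
      intro a
      rw [← ENNReal.rpow_natCast, ← ENNReal.rpow_mul]; simp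
    simp_rw [hsq, hsq1] at cs
    set K := lintegralPowLePowLIntegralFDerivConst (volume : Measure (Rn 2)) 2
    calc ∫⁻ x, ‖u x‖ₑ ^ (2 * (k + 1 + 1)) = ∫⁻ x, ‖u x ^ (k + 2)‖ₑ ^ (2 : ℝ) := by
          congr with x
          rw [enorm_pow, ← ENNReal.rpow_natCast, ← ENNReal.rpow_natCast, ← ENNReal.rpow_mul]
          congr 1; push_cast; ring
      _ ≤ K * (∫⁻ x, ‖fderiv ℝ (fun x => u x ^ (k + 2)) x‖ₑ) ^ (2 : ℝ) := key
      _ ≤ K * (∫⁻ x, ((k + 2 : ℝ≥0) : ℝ≥0∞) * (‖u x‖ₑ ^ (k + 1) * ‖fderiv ℝ u x‖ₑ)) ^ (2 : ℝ) := by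
          gcongr with x; exact hd x
      _ = K * (((k + 2 : ℝ≥0) : ℝ≥0∞) * ∫⁻ x, (‖u x‖ₑ ^ (k + 1) * ‖fderiv ℝ u x‖ₑ)) ^ 2 := by
          rw [lintegral_const_mul' _ _ ENNReal.coe_ne_top, ← ENNReal.rpow_natCast]; norm_num
      _ ≤ K * (((k + 2 : ℝ≥0) : ℝ≥0∞) * ((∫⁻ x, ‖u x‖ₑ ^ (2 * (k + 1))) ^ (1 / 2 : ℝ) *
            (∫⁻ x, ‖fderiv ℝ u x‖ₑ ^ 2) ^ (1 / 2 : ℝ))) ^ 2 := by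
          gcongr
      _ = K * ((k + 2 : ℝ≥0) : ℝ≥0∞) ^ 2 * (∫⁻ x, ‖u x‖ₑ ^ (2 * (k + 1))) *
            (∫⁻ x, ‖fderiv ℝ u x‖ₑ ^ 2) := by
          rw [mul_pow, mul_pow, hsq2, hsq2]; ring
      _ ≤ K * ((k + 2 : ℝ≥0) : ℝ≥0∞) ^ 2 *
            (C * (∫⁻ x, ‖u x‖ₑ ^ 2) * (∫⁻ x, ‖fderiv ℝ u x‖ₑ ^ 2) ^ k) *
            (∫⁻ x, ‖fderiv ℝ u x‖ₑ ^ 2) := by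
          gcongr; exact hC u hu h2u
      _ = _ := by
          push_cast; ring

lemma gn_endpoint (n : ℕ) (hn : 2 ≤ n) (r : ℝ) (hr : 2 ≤ r)
    (hr' : 2 < n → r ≤ 2 * n / ((n : ℝ) - 2)) :
    ∃ (q σ : ℝ) (C : ℝ≥0), r ≤ q ∧ 0 < σ ∧ σ ≤ 1 ∧ σ = n * (1 / 2 - 1 / q) ∧
      ∀ u : Rn n → ℂ, ContDiff ℝ 1 u → HasCompactSupport u →
      (∫⁻ x, ‖u x‖ₑ ^ q) ^ (1 / q) ≤ C * ((∫⁻ x, ‖u x‖ₑ ^ (2 : ℝ)) ^ (1 / 2 : ℝ)) ^ (1 - σ) *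
        ((∫⁻ x, ‖fderiv ℝ u x‖ₑ ^ (2 : ℝ)) ^ (1 / 2 : ℝ)) ^ σ := by
  rcases hn.eq_or_lt with rfl | hn3
  · obtain ⟨k, hk⟩ := exists_nat_ge r
    obtain ⟨C, hC⟩ := gn_dim2 k
    have hk0 : (0 : ℝ) < k := by linarith
    refine ⟨2 * (k + 1), k / (k + 1), C ^ (1 / (2 * (k + 1)) : ℝ), by linarith, by positivity,
      ?_, ?_, fun u hu h2u => ?_⟩
    · rw [div_le_one (by positivity)]; linarith
    · push_cast; field_simp; ring
    · have := ENNReal.rpow_le_rpow (hC u hu h2u) (by positivity : (0 : ℝ) ≤ 1 / (2 * (k + 1)))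
      rw [ENNReal.mul_rpow_of_nonneg _ _ (by positivity),
        ENNReal.mul_rpow_of_nonneg _ _ (by positivity)] at this
      simp only [← ENNReal.rpow_natCast, ← ENNReal.rpow_mul] at this ⊢
      push_cast at this
      rw [ENNReal.coe_rpow_of_nonneg _ (by positivity)]
      refine this.trans (le_of_eq ?_)
      congr 2
      · congr 1; field_simp; ring
      · field_simp
  · have hnR : (2 : ℝ) < n := by exact_mod_cast hn3
    have hn2 : (0 : ℝ) < n - 2 := by linarith
    set q : ℝ≥0 := ⟨2 * n / ((n : ℝ) - 2), by positivity⟩ with hq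
    have hqv : (q : ℝ) = 2 * n / ((n : ℝ) - 2) := rfl
    refine ⟨q, 1, SNormLESNormFDerivOfEqConst ℂ (volume : Measure (Rn n)) (2 : ℝ≥0), ?_, one_pos,
      le_rfl, ?_, fun u hu h2u => ?_⟩
    · rw [hqv]; exact hr' hn3
    · rw [hqv]; field_simp; ring
    · have := eLpNorm_le_eLpNorm_fderiv_of_eq (volume : Measure (Rn n)) hu h2u (p := 2) (p' := q)
        (by norm_num) (by simp; omega) (by
          rw [hqv]; simp only [finrank_euclideanSpace, Fintype.card_fin]; push_cast
          field_simp)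
      have hq0 : q ≠ 0 := by
        rw [← NNReal.coe_ne_zero, hqv]; positivity
      rw [eLpNorm_nnreal_eq_lintegral hq0, eLpNorm_nnreal_eq_lintegral two_ne_zero] at this
      simpa using this

lemma gn_compact (n : ℕ) (hn : 2 ≤ n) (r : ℝ) (hr : 2 ≤ r)
    (hr' : 2 < n → r ≤ 2 * n / ((n : ℝ) - 2)) :
    (n : ℝ) * (1 / 2 - 1 / r) ≤ 1 ∧
    ∃ C : ℝ≥0, ∀ u : Rn n → ℂ, ContDiff ℝ 1 u → HasCompactSupport u →
      eLpNorm u (ENNReal.ofReal r) volume ≤ C * eLpNorm u 2 volume ^ (1 - (n : ℝ) * (1 / 2 - 1 / r)) *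
        eLpNorm (fderiv ℝ u) 2 volume ^ ((n : ℝ) * (1 / 2 - 1 / r)) := by
  obtain ⟨q, σ, C, hrq, hσ0, hσ1, hσ, H⟩ := gn_endpoint n hn r hr hr'
  have hr0 : 0 < r := by linarith
  have hq0 : 0 < q := by linarith
  have hn0 : (0 : ℝ) < n := by positivity
  set δ := (n : ℝ) * (1 / 2 - 1 / r) with hδ
  have hδ0 : 0 ≤ δ := by
    have : 1 / r ≤ 1 / 2 := one_div_le_one_div_of_le two_pos hr
    exact mul_nonneg hn0.le (by linarith)
  have hδσ : δ ≤ σ := by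
    have : 1 / q ≤ 1 / r := one_div_le_one_div_of_le hr0 hrq
    rw [hσ, hδ]; gcongr
  refine ⟨hδσ.trans hσ1, C ^ (δ / σ), fun u hu h2u => ?_⟩
  have hθ0 : 0 ≤ δ / σ := by positivity
  have hθ1 : δ / σ ≤ 1 := (div_le_one hσ0).2 hδσ
  have hθσ : δ / σ * σ = δ := by field_simp
  have e1 : 1 / r = (1 - δ / σ) / 2 + (δ / σ) / q := by
    have h1 : (1 - δ / σ) / 2 + (δ / σ) / q = 1 / 2 - (δ / σ) * (1 / 2 - 1 / q) := by ring
    have h2 : 1 / 2 - 1 / q = σ / n := by rw [hσ]; field_simp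
    have h3 : δ / n = 1 / 2 - 1 / r := by rw [hδ]; field_simp
    rw [h1, h2, ← mul_div_assoc, hθσ, h3]; ring
  have hm : AEMeasurable (fun x => ‖u x‖ₑ) (volume : Measure (Rn n)) :=
    hu.continuous.enorm.measurable.aemeasurable
  have key := gn_interp hm hr0 hq0 hθ0 hθ1 e1
  rw [eLpNorm_eq_lintegral_rpow_enorm_toReal (by simpa using hr0) (by simp),
    eLpNorm_eq_lintegral_rpow_enorm_toReal two_ne_zero (by simp),
    eLpNorm_eq_lintegral_rpow_enorm_toReal two_ne_zero (by simp), ENNReal.toReal_ofReal hr0.le,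
    ENNReal.toReal_ofNat]
  refine key.trans ?_
  grw [H u hu h2u]
  rw [ENNReal.mul_rpow_of_nonneg _ _ hθ0, ENNReal.mul_rpow_of_nonneg _ _ hθ0,
    ← ENNReal.rpow_mul _ σ, mul_comm σ, hθσ, ← ENNReal.rpow_mul _ (1 - σ),
    ← ENNReal.coe_rpow_of_nonneg _ hθ0]
  set N := (∫⁻ x, ‖u x‖ₑ ^ (2 : ℝ)) ^ (1 / 2 : ℝ)
  have e2 : N ^ (1 - δ) = N ^ (1 - δ / σ) * N ^ ((1 - σ) * (δ / σ)) := by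
    rw [← ENNReal.rpow_add_of_nonneg _ _ (by linarith) (mul_nonneg (by linarith) hθ0)]
    congr 1
    field_simp; ring
  rw [e2]
  exact le_of_eq (by ring)

/-- Gagliardo–Nirenberg for `C¹` functions in `L²`. -/
lemma gn_C1 (n : ℕ) (hn : 2 ≤ n) (r : ℝ) (hr : 2 ≤ r)
    (hr' : 2 < n → r ≤ 2 * n / ((n : ℝ) - 2)) :
    ∃ C : ℝ≥0, ∀ u : Rn n → ℂ, ContDiff ℝ 1 u → eLpNorm u 2 volume ≠ ⊤ →
      eLpNorm u (ENNReal.ofReal r) volume ≤ C * eLpNorm u 2 volume ^ (1 - (n : ℝ) * (1 / 2 - 1 / r)) *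
        eLpNorm (fderiv ℝ u) 2 volume ^ ((n : ℝ) * (1 / 2 - 1 / r)) := by
  obtain ⟨hδ1, C, H⟩ := gn_compact n hn r hr hr'
  refine ⟨C, fun u hu h2 => ?_⟩
  have hδ0 : 0 ≤ (n : ℝ) * (1 / 2 - 1 / r) := by
    have : 1 / r ≤ 1 / 2 := one_div_le_one_div_of_le two_pos hr
    exact mul_nonneg (by positivity) (by linarith)
  set δ := (n : ℝ) * (1 / 2 - 1 / r) with hδ
  let χ : ContDiffBump (0 : Rn n) := ⟨1, 2, one_pos, one_lt_two⟩
  have hχ : ContDiff ℝ 1 (χ : Rn n → ℝ) := χ.contDiff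
  obtain ⟨K, hK⟩ := (hχ.continuous_fderiv one_ne_zero).bounded_above_of_compact_support
    (χ.hasCompactSupport.fderiv (𝕜 := ℝ))
  have hK0 : 0 ≤ K := (norm_nonneg _).trans (hK 0)
  let c : ℕ → ℝ := fun m => ((m : ℝ) + 1)⁻¹
  have hc : ∀ m, 0 < c m := fun m => by positivity
  have hclim : Tendsto c atTop (𝓝 0) := by
    simpa [c, one_div] using tendsto_one_div_add_atTop_nhds_zero_nat (𝕜 := ℝ)
  let v : ℕ → Rn n → ℂ := fun m x => χ (c m • x) • u x
  have hη : ∀ m, ContDiff ℝ 1 (fun x : Rn n => χ (c m • x)) := fun m =>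
    hχ.comp (contDiff_const_smul _)
  have hv : ∀ m, ContDiff ℝ 1 (v m) := fun m => (hη m).smul hu
  have hvc : ∀ m, HasCompactSupport (v m) := fun m =>
    (χ.hasCompactSupport.comp_smul (hc m).ne').smul_right
  have hvn : ∀ m, eLpNorm (v m) 2 volume ≤ eLpNorm u 2 volume := fun m => by
    refine eLpNorm_mono fun x => ?_
    simp only [v, norm_smul, Real.norm_eq_abs, abs_of_nonneg χ.nonneg]
    exact mul_le_of_le_one_left (norm_nonneg _) χ.le_one
  have hdη : ∀ m x, ‖fderiv ℝ (fun x : Rn n => χ (c m • x)) x‖ ≤ c m * K := by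
    intro m x
    rw [fderiv_comp_smul, norm_smul, Real.norm_of_nonneg (hc m).le]
    exact mul_le_mul_of_nonneg_left (hK _) (hc m).le
  have hdv : ∀ m, eLpNorm (fderiv ℝ (v m)) 2 volume ≤
      eLpNorm (fderiv ℝ u) 2 volume + ENNReal.ofReal (c m * K) * eLpNorm u 2 volume := by
    intro m
    have h1 : eLpNorm (fderiv ℝ (v m)) 2 volume ≤
        eLpNorm ((fun x => ‖fderiv ℝ u x‖) + (c m * K) • (fun x => ‖u x‖)) 2 volume := by
      refine eLpNorm_mono_real fun x => ?_
      have : fderiv ℝ (v m) x = _ :=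
        fderiv_fun_smul ((hη m).differentiable one_ne_zero x) (hu.differentiable one_ne_zero x)
      rw [this]
      refine (norm_add_le _ _).trans ?_
      rw [norm_smul, Real.norm_of_nonneg χ.nonneg, ContinuousLinearMap.norm_smulRight_apply]
      simp only [Pi.add_apply, Pi.smul_apply, smul_eq_mul]
      gcongr
      · exact mul_le_of_le_one_left (norm_nonneg _) χ.le_one
      · exact hdη m x
    refine h1.trans ((eLpNorm_add_le ?_ ?_ (by norm_num)).trans ?_)
    · exact (hu.continuous_fderiv one_ne_zero).norm.aestronglyMeasurable
    · exact (hu.continuous.norm.const_smul _).aestronglyMeasurable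
    · rw [eLpNorm_const_smul, eLpNorm_norm, eLpNorm_norm,
        Real.enorm_of_nonneg (mul_nonneg (hc m).le hK0)]
  have hlim : ∀ x, Tendsto (fun m => v m x) atTop (𝓝 (u x)) := by
    intro x
    have h1 : Tendsto (fun m => c m • x) atTop (𝓝 0) := by
      simpa using hclim.smul_const x
    have h2 := (hχ.continuous.tendsto 0).comp h1
    have h3 : χ (0 : Rn n) = 1 := χ.one_of_mem_closedBall (by simp [χ])
    rw [h3] at h2
    simpa [v] using h2.smul_const (u x)
  have hfatou := Lp.eLpNorm_lim_le_liminf_eLpNorm (p := ENNReal.ofReal r) (μ := volume)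
    (fun m => (hv m).continuous.aestronglyMeasurable) u (ae_of_all _ hlim)
  let R : ℕ → ℝ≥0∞ := fun m => C * eLpNorm u 2 volume ^ (1 - δ) *
      (eLpNorm (fderiv ℝ u) 2 volume + ENNReal.ofReal (c m * K) * eLpNorm u 2 volume) ^ δ
  have hle : ∀ m, eLpNorm (v m) (ENNReal.ofReal r) volume ≤ R m := fun m => by
    refine (H (v m) (hv m) (hvc m)).trans ?_
    have : 0 ≤ 1 - δ := by linarith
    simp only [R]
    gcongr
    · exact hvn m
    · exact hdv m
  have hR : Tendsto R atTop (𝓝 (C * eLpNorm u 2 volume ^ (1 - δ) *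
      eLpNorm (fderiv ℝ u) 2 volume ^ δ)) := by
    refine ENNReal.Tendsto.const_mul ?_ (Or.inr ?_)
    · refine (ENNReal.continuous_rpow_const.tendsto _).comp ?_
      have h1 : Tendsto (fun m => ENNReal.ofReal (c m * K)) atTop (𝓝 0) := by
        have := ENNReal.tendsto_ofReal (hclim.mul_const K)
        simpa using this
      have h2 := ENNReal.Tendsto.mul_const (b := eLpNorm u 2 volume) h1 (Or.inr h2)
      simpa using h2.const_add (eLpNorm (fderiv ℝ u) 2 volume)
    · exact ENNReal.mul_ne_top ENNReal.coe_ne_top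
        (ENNReal.rpow_ne_top_of_nonneg (by linarith) h2)
  calc _ ≤ _ := hfatou
    _ ≤ atTop.liminf R := liminf_le_liminf (Eventually.of_forall hle)
    _ = _ := hR.liminf_eq

/-- The common form `a x φ + i b ∇φ` of both operators. -/
def gnOp {n : ℕ} (a b : ℝ) (φ : Rn n → ℂ) (x : Rn n) : EuclideanSpace ℂ (Fin n) :=
  (WithLp.equiv 2 (Fin n → ℂ)).symm
    (fun j => (a : ℂ) * (x j : ℂ) * φ x + Complex.I * (b : ℂ) * grad φ x j)

/-- Multiplication by a quadratic phase. -/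
def gnGauge {n : ℕ} (s : ℝ) (φ : Rn n → ℂ) (x : Rn n) : ℂ :=
  Complex.exp (((s * ‖x‖ ^ 2 : ℝ) : ℂ) * Complex.I) * φ x

lemma gnGauge_norm {n : ℕ} (s : ℝ) (φ : Rn n → ℂ) (x : Rn n) : ‖gnGauge s φ x‖ = ‖φ x‖ := by
  rw [gnGauge, norm_mul, Complex.norm_exp_ofReal_mul_I, one_mul]

lemma gnGauge_contDiff {n : ℕ} (s : ℝ) {φ : Rn n → ℂ} (hφ : ContDiff ℝ 1 φ) :
    ContDiff ℝ 1 (gnGauge s φ) := by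
  unfold gnGauge
  refine ContDiff.mul (ContDiff.cexp (ContDiff.mul ?_ contDiff_const)) hφ
  exact Complex.ofRealCLM.contDiff.comp (contDiff_const.mul (contDiff_norm_sq ℝ))

lemma gnGauge_fderiv_apply {n : ℕ} (s : ℝ) {φ : Rn n → ℂ} (hφ : ContDiff ℝ 1 φ) (x v : Rn n) :
    fderiv ℝ (gnGauge s φ) x v = Complex.exp (((s * ‖x‖ ^ 2 : ℝ) : ℂ) * Complex.I) *
      (fderiv ℝ φ x v + 2 * s * inner ℝ x v * Complex.I * φ x) := by
  have h1 : HasFDerivAt (fun x : Rn n => s * ‖x‖ ^ 2) (s • (2 • innerSL ℝ x)) x :=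
    (hasStrictFDerivAt_norm_sq x).hasFDerivAt.const_mul s
  have h2 := ((Complex.ofRealCLM.hasFDerivAt.comp x h1).mul_const Complex.I).cexp
  have h3 := h2.mul (hφ.differentiable one_ne_zero x).hasFDerivAt
  have h4 : HasFDerivAt (gnGauge s φ) _ x := h3
  rw [h4.fderiv]
  simp
  ring

lemma gn_fderiv_apply {n : ℕ} (L : Rn n →L[ℝ] ℂ) (v : Rn n) :
    L v = ∑ j, (v j : ℂ) * L (EuclideanSpace.single j 1) := by
  conv_lhs => rw [← (EuclideanSpace.basisFun (Fin n) ℝ).sum_repr v]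
  simp

lemma gnGauge_fderiv_norm {n : ℕ} (a b : ℝ) (hb : b ≠ 0) {φ : Rn n → ℂ} (hφ : ContDiff ℝ 1 φ)
    (x : Rn n) : ‖fderiv ℝ (gnGauge (-(a / (2 * b))) φ) x‖ ≤ |b|⁻¹ * ‖gnOp a b φ x‖ := by
  refine ContinuousLinearMap.opNorm_le_bound _ (by positivity) fun v => ?_
  have hbC : (b : ℂ) ≠ 0 := by exact_mod_cast hb
  have h1 : fderiv ℝ φ x v + 2 * ((-(a / (2 * b)) : ℝ) : ℂ) * inner ℝ x v * Complex.I * φ x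
      = (Complex.I * b)⁻¹ * ∑ j, (v j : ℂ) * gnOp a b φ x j := by
    rw [gn_fderiv_apply (fderiv ℝ φ x) v, eq_inv_mul_iff_mul_eq₀ (by simp [hbC])]
    have : ((inner ℝ x v : ℝ) : ℂ) = ∑ j, (v j : ℂ) * (x j : ℂ) := by
      simp [PiLp.inner_apply]
    rw [this]
    simp only [gnOp, grad, Finset.mul_sum, Finset.sum_mul, ← Finset.sum_add_distrib]
    refine Finset.sum_congr rfl fun j _ => ?_
    simp only [WithLp.equiv_symm_apply, PiLp.toLp_apply]
    push_cast
    field_simp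
    linear_combination (-a * v j * x j * φ x) * Complex.I_sq
  rw [gnGauge_fderiv_apply _ hφ, h1, norm_mul, Complex.norm_exp_ofReal_mul_I, one_mul, norm_mul,
    norm_inv, norm_mul, Complex.norm_I, one_mul, Complex.norm_real, Real.norm_eq_abs, mul_assoc]
  gcongr
  calc ‖∑ j, (v j : ℂ) * gnOp a b φ x j‖ ≤ ∑ j, ‖gnOp a b φ x j‖ * ‖v j‖ := by
        refine (norm_sum_le _ _).trans (le_of_eq (Finset.sum_congr rfl fun j _ => ?_))
        rw [norm_mul, Complex.norm_real, mul_comm]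
    _ ≤ _ := Real.sum_mul_le_sqrt_mul_sqrt _ _ _
    _ = _ := by rw [EuclideanSpace.norm_eq, EuclideanSpace.norm_eq]

lemma gn_main (n : ℕ) (hn : 2 ≤ n) (r : ℝ) (hr : 2 ≤ r)
    (hr' : 2 < n → r ≤ 2 * n / ((n : ℝ) - 2)) :
    ∃ C : ℝ, 0 < C ∧ ∀ a b : ℝ, (b = 0 → a ≠ 0) → ∀ φ : SchwartzMap (Rn n) ℂ,
      eLpNorm (⇑φ) (ENNReal.ofReal r) volume
        ≤ ENNReal.ofReal C * ENNReal.ofReal |b| ^ (-((n : ℝ) * (1 / 2 - 1 / r)))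
          * eLpNorm (⇑φ) 2 volume ^ (1 - (n : ℝ) * (1 / 2 - 1 / r))
          * eLpNorm (gnOp a b ⇑φ) 2 volume ^ ((n : ℝ) * (1 / 2 - 1 / r)) := by
  obtain ⟨hδ1, -⟩ := gn_compact n hn r hr hr'
  obtain ⟨C, H⟩ := gn_C1 n hn r hr hr'
  refine ⟨C + 1, by positivity, fun a b hab φ => ?_⟩
  have hφ : ContDiff ℝ 1 φ := φ.smooth 1
  have hφ2 : eLpNorm φ 2 volume ≠ ⊤ := (φ.memLp 2 volume).2.ne
  have hC : (C : ℝ≥0∞) ≤ ENNReal.ofReal (C + 1) := by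
    rw [← ENNReal.ofReal_coe_nnreal]; exact ENNReal.ofReal_le_ofReal (by linarith)
  have hn0 : (0 : ℝ) < n := by positivity
  by_cases hb : b = 0
  · rcases hr.eq_or_lt with rfl | hr2
    · simp only [sub_self, mul_zero, neg_zero, ENNReal.rpow_zero, mul_one, sub_zero,
        ENNReal.rpow_one]
      rw [show ENNReal.ofReal 2 = 2 by simp]
      exact le_mul_of_one_le_left' (by rw [ENNReal.one_le_ofReal]; simp)
    · have hδ0 : 0 < (n : ℝ) * (1 / 2 - 1 / r) := by
        have : 1 / r < 1 / 2 := one_div_lt_one_div_of_lt two_pos hr2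
        exact mul_pos hn0 (by linarith)
      set δ := (n : ℝ) * (1 / 2 - 1 / r) with hδ
      by_cases h0 : (φ : Rn n → ℂ) =ᵐ[volume] 0
      · rw [eLpNorm_congr_ae h0]; simp
      have h1 : eLpNorm φ 2 volume ^ (1 - δ) ≠ 0 := by
        rw [Ne, ENNReal.rpow_eq_zero_iff]
        rw [eLpNorm_eq_zero_iff φ.continuous.aestronglyMeasurable two_ne_zero]
        simp [h0, hφ2]
      have h2 : eLpNorm (gnOp a b φ) 2 volume ^ δ ≠ 0 := by
        rw [Ne, ENNReal.rpow_eq_zero_iff_of_pos hδ0]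
        intro h
        have hm : eLpNorm (fun x => (a * ‖x‖ : ℝ) • φ x) 2 volume ≤ eLpNorm (gnOp a b φ) 2 volume := by
          refine eLpNorm_mono fun x => le_of_eq ?_
          have : gnOp a b φ x = (φ x * a) • (WithLp.toLp 2 (fun j => (x j : ℂ)) :
              EuclideanSpace ℂ (Fin n)) := by
            ext j
            simp [gnOp, hb]; ring
          rw [this, norm_smul, norm_smul, norm_mul, norm_mul, EuclideanSpace.norm_eq x,
            EuclideanSpace.norm_eq]
          simp [abs_of_nonneg (Real.sqrt_nonneg _)]
          ring
        rw [h, nonpos_iff_eq_zero, eLpNorm_eq_zero_iff (by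
          exact Continuous.aestronglyMeasurable (by have := φ.continuous; fun_prop)) two_ne_zero] at hm
        apply h0
        have : Nonempty (Fin n) := ⟨⟨0, by omega⟩⟩
        have hne : ∀ᵐ x : Rn n ∂volume, x ≠ 0 := by
          have : Nontrivial (Rn n) := inferInstance
          exact Measure.ae_ne volume 0
        filter_upwards [hm, hne] with x hx hx0
        simpa [hab hb, hx0] using hx
      have h3 : ENNReal.ofReal |b| ^ (-δ) = ⊤ := by
        rw [hb]; simp [ENNReal.zero_rpow_of_neg, hδ0]
      rw [h3, ENNReal.mul_top (by simp; positivity), ENNReal.top_mul h1, ENNReal.top_mul h2]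
      exact le_top
  · have hδ0 : 0 ≤ (n : ℝ) * (1 / 2 - 1 / r) := by
      have : 1 / r ≤ 1 / 2 := one_div_le_one_div_of_le two_pos hr
      exact mul_nonneg hn0.le (by linarith)
    set δ := (n : ℝ) * (1 / 2 - 1 / r) with hδ
    set ψ := gnGauge (-(a / (2 * b))) φ with hψ
    have hn : ∀ p, eLpNorm ψ p volume = eLpNorm φ p volume := fun p =>
      eLpNorm_congr_norm_ae (ae_of_all _ fun x => gnGauge_norm _ _ x)
    have key := H ψ (gnGauge_contDiff _ hφ) (by rwa [hn])
    rw [hn, hn] at key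
    have hd : eLpNorm (fderiv ℝ ψ) 2 volume ≤
        (ENNReal.ofReal |b|)⁻¹ * eLpNorm (gnOp a b φ) 2 volume := by
      have := eLpNorm_le_mul_eLpNorm_of_ae_le_mul (μ := volume)
        (ae_of_all _ fun x => gnGauge_fderiv_norm a b hb hφ x) 2
      rwa [ENNReal.ofReal_inv_of_pos (abs_pos.2 hb)] at this
    calc _ ≤ _ := key
      _ ≤ ENNReal.ofReal (C + 1) * eLpNorm φ 2 volume ^ (1 - δ) *
          ((ENNReal.ofReal |b|)⁻¹ * eLpNorm (gnOp a b φ) 2 volume) ^ δ := by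
        gcongr
      _ = _ := by
        rw [ENNReal.mul_rpow_of_nonneg _ _ hδ0, ENNReal.inv_rpow, ← ENNReal.rpow_neg]
        ring

/-- the modified (weighted) Gagliardo–Nirenberg inequalities for J^ε and H^ε:
‖φ‖_{L^r} ≤ C |cos t|^{−δ(r)} ‖φ‖_{L²}^{1−δ(r)} ‖J^ε(t)φ‖_{L²}^{δ(r)} and
‖φ‖_{L^r} ≤ C (ε|sin t|)^{−δ(r)} ‖φ‖_{L²}^{1−δ(r)} ‖H^ε(t)φ‖_{L²}^{δ(r)},
with δ(r) = n(1/2 − 1/r) and C depending only on n and r. The inequalities are stated in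
ℝ≥0∞, so that they are trivially true when cos t = 0 (resp. sin t = 0), since
0^{−δ(r)} = ∞ there. -/
theorem stmt2 (n : ℕ) (hn : 2 ≤ n) (r : ℝ) (hr : 2 ≤ r)
    (hr' : 2 < n → r ≤ 2 * n / ((n : ℝ) - 2)) :
    ∃ C : ℝ, 0 < C ∧ ∀ ε ∈ Set.Ioc (0 : ℝ) 1, ∀ t : ℝ, ∀ φ : SchwartzMap (Rn n) ℂ,
      (eLpNorm (⇑φ) (ENNReal.ofReal r) volume
        ≤ ENNReal.ofReal C * ENNReal.ofReal |Real.cos t| ^ (-((n : ℝ) * (1 / 2 - 1 / r)))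
          * eLpNorm (⇑φ) 2 volume ^ (1 - (n : ℝ) * (1 / 2 - 1 / r))
          * eLpNorm (JopE ε t ⇑φ) 2 volume ^ ((n : ℝ) * (1 / 2 - 1 / r)))
      ∧ (eLpNorm (⇑φ) (ENNReal.ofReal r) volume
        ≤ ENNReal.ofReal C
          * ENNReal.ofReal (ε * |Real.sin t|) ^ (-((n : ℝ) * (1 / 2 - 1 / r)))
          * eLpNorm (⇑φ) 2 volume ^ (1 - (n : ℝ) * (1 / 2 - 1 / r))
          * eLpNorm (HopE ε t ⇑φ) 2 volume ^ ((n : ℝ) * (1 / 2 - 1 / r))) := by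
  obtain ⟨C, hC, H⟩ := gn_main n hn r hr hr'
  refine ⟨C, hC, fun ε hε t φ => ⟨?_, ?_⟩⟩
  · have h1 : JopE ε t φ = gnOp (Real.sin t / ε) (-Real.cos t) φ := by
      ext x j
      simp only [JopE, Jop, gnOp, WithLp.equiv_symm_apply, PiLp.toLp_apply]
      push_cast
      ring
    have h2 := H (Real.sin t / ε) (-Real.cos t) (fun h h' => by
      have := Real.sin_sq_add_cos_sq t
      rw [neg_eq_zero.1 h, (div_eq_zero_iff.1 h').resolve_right hε.1.ne'] at this
      norm_num at this) φ
    rwa [abs_neg, ← h1] at h2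
  · have h1 : HopE ε t φ = gnOp (Real.cos t) (ε * Real.sin t) φ := by
      ext x j
      simp only [HopE, Hop, gnOp, WithLp.equiv_symm_apply, PiLp.toLp_apply]
      push_cast
      ring
    have h2 := H (Real.cos t) (ε * Real.sin t) (fun h h' => by
      have := Real.sin_sq_add_cos_sq t
      rw [h', (mul_eq_zero.1 h).resolve_left hε.1.ne'] at this
      norm_num at this) φ
    rwa [abs_mul, abs_of_pos hε.1, ← h1] at h2

end
end

section
/- Let n ≥ 1, 0 < γ < n, ε > 0 and t ∈ ℝ. For φ : ℝⁿ → ℂ in the Schwartz class, write (|x|^{−γ}∗ψ)(x) := ∫_{ℝⁿ}|x−y|^{−γ}ψ(y)dy. Then the action of J^ε(t) on the Hartree nonlinearity is given, componentwise and pointwise in x, by J^ε(t)( (|x|^{−γ}∗|φ|²) φ ) = (|x|^{−γ}∗|φ|²)·J^ε(t)φ + 2i ( |x|^{−γ} ∗ Im( φ̄ · J^ε(t)φ ) ) φ, where φ̄ denotes the complex conjugate of φ and Im is taken componentwise; the same identity holds with J^ε(t) replaced by H^ε(t). -/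
open MeasureTheory Real Filter Topology
open scoped ENNReal NNReal ComplexConjugate

noncomputable section

/-- The kernel times an integrable polynomial weight is integrable. -/
lemma kernel_weight_integrable {n : ℕ} (hn : 1 ≤ n) {γ : ℝ} (hγ0 : 0 < γ) (hγn : γ < n) :
    Integrable (fun y : Rn n => ‖y‖ ^ (-γ) * ((1 + ‖y‖) ^ (n + 1))⁻¹) := by
  have hmeas : AEStronglyMeasurable
      (fun y : Rn n => ‖y‖ ^ (-γ) * ((1 + ‖y‖) ^ (n + 1))⁻¹) volume := by
    apply Measurable.aestronglyMeasurable
    fun_prop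
  have hw : ∀ y : Rn n, 1 ≤ (1 + ‖y‖) ^ (n + 1) := fun y =>
    one_le_pow₀ (by linarith [norm_nonneg y])
  have h1 : IntegrableOn (fun y : Rn n => ‖y‖ ^ (-γ) * ((1 + ‖y‖) ^ (n + 1))⁻¹)
      (Metric.ball 0 1) := by
    refine integrableOn_ball_of_norm_le_rpow (C := 1) (α := γ) (by simpa using hn)
      (by simpa using hγn) ?_ hmeas
    refine Eventually.of_forall fun y => ?_
    have h0 : 0 ≤ ‖y‖ ^ (-γ) := rpow_nonneg (norm_nonneg _) _
    have h2 : 0 < (1 + ‖y‖) ^ (n + 1) := lt_of_lt_of_le one_pos (hw y)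
    rw [Real.norm_of_nonneg (by positivity), one_mul]
    exact mul_le_of_le_one_right h0 (inv_le_one_of_one_le₀ (hw y))
  have h2 : IntegrableOn (fun y : Rn n => ‖y‖ ^ (-γ) * ((1 + ‖y‖) ^ (n + 1))⁻¹)
      (Metric.ball 0 1)ᶜ := by
    have hi : Integrable (fun y : Rn n => (1 + ‖y‖) ^ (-((n : ℝ) + 1))) :=
      integrable_one_add_norm (by simp)
    refine Integrable.mono' hi.integrableOn hmeas.restrict ?_
    refine (ae_restrict_iff' measurableSet_ball.compl).2 (Eventually.of_forall fun y hy => ?_)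
    have hy1 : 1 ≤ ‖y‖ := by simpa using hy
    have h0 : 0 ≤ ‖y‖ ^ (-γ) := rpow_nonneg (norm_nonneg _) _
    have h3 : 0 < (1 + ‖y‖) ^ (n + 1) := lt_of_lt_of_le one_pos (hw y)
    rw [Real.norm_of_nonneg (by positivity), Real.rpow_neg (x := 1 + ‖y‖) (by positivity),
      show ((n : ℝ) + 1) = ((n + 1 : ℕ) : ℝ) by push_cast; rfl, Real.rpow_natCast]
    exact mul_le_of_le_one_left (by positivity)
      (Real.rpow_le_one_of_one_le_of_nonpos hy1 (by linarith))
  have := h1.union h2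
  rwa [Set.union_compl_self, integrableOn_univ] at this

lemma weight_shift {n : ℕ} (x y : Rn n) :
    ((1 + ‖x - y‖) ^ (n + 1))⁻¹ ≤ (1 + ‖x‖) ^ (n + 1) * ((1 + ‖y‖) ^ (n + 1))⁻¹ := by
  have hx := norm_nonneg x
  have hy := norm_nonneg y
  have hxy := norm_nonneg (x - y)
  have h : 1 + ‖y‖ ≤ (1 + ‖x‖) * (1 + ‖x - y‖) := by
    have : ‖y‖ ≤ ‖x‖ + ‖x - y‖ := by
      have := norm_sub_le x (x - y)
      simpa using this
    nlinarith
  have h2 : (1 + ‖y‖) ^ (n + 1) ≤ (1 + ‖x‖) ^ (n + 1) * (1 + ‖x - y‖) ^ (n + 1) := by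
    rw [← mul_pow]; gcongr
  rw [← div_eq_mul_inv, le_div_iff₀ (by positivity), inv_mul_le_iff₀ (by positivity)]
  linarith

lemma conv_eq {n : ℕ} (γ : ℝ) (ψ : Rn n → ℝ) (x : Rn n) :
    conv γ ψ x = ∫ y : Rn n, ‖y‖ ^ (-γ) * ψ (x - y) := by
  unfold conv
  rw [← integral_sub_left_eq_self (fun y => ‖x - y‖ ^ (-γ) * ψ y) volume x]
  simp

lemma conv_hasFDerivAt {n : ℕ} (hn : 1 ≤ n) {γ : ℝ} (hγ0 : 0 < γ) (hγn : γ < n)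
    (ρ : Rn n → ℝ) (hρ : ContDiff ℝ 1 ρ) (C : ℝ)
    (hC0 : ∀ z, |ρ z| ≤ C * ((1 + ‖z‖) ^ (n + 1))⁻¹)
    (hC1 : ∀ z, ‖fderiv ℝ ρ z‖ ≤ C * ((1 + ‖z‖) ^ (n + 1))⁻¹) (x : Rn n) :
    ∃ L : Rn n →L[ℝ] ℝ, HasFDerivAt (conv γ ρ) L x ∧
      ∀ v, L v = conv γ (fun z => fderiv ℝ ρ z v) x := by
  have hK := kernel_weight_integrable hn hγ0 hγn
  have hC : 0 ≤ C := by
    have := (abs_nonneg _).trans (hC0 0)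
    simpa using this
  have hk0 : ∀ y : Rn n, 0 ≤ ‖y‖ ^ (-γ) := fun y => rpow_nonneg (norm_nonneg _) _
  have hkm : Measurable fun y : Rn n => ‖y‖ ^ (-γ) := by fun_prop
  have hρ' : Continuous (fderiv ℝ ρ) := hρ.continuous_fderiv one_ne_zero
  have hm : ∀ x', AEStronglyMeasurable (fun y : Rn n => ‖y‖ ^ (-γ) * ρ (x' - y)) volume :=
    fun x' => hkm.aestronglyMeasurable.mul
      (hρ.continuous.comp (continuous_const.sub continuous_id)).aestronglyMeasurable
  have hm' : AEStronglyMeasurable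
      (fun y : Rn n => (‖y‖ ^ (-γ)) • fderiv ℝ ρ (x - y)) volume :=
    hkm.aestronglyMeasurable.smul
      (hρ'.comp (continuous_const.sub continuous_id)).aestronglyMeasurable
  have hb : ∀ y : Rn n, ∀ x' ∈ Metric.ball x 1, ‖(‖y‖ ^ (-γ)) • fderiv ℝ ρ (x' - y)‖ ≤
      C * (2 + ‖x‖) ^ (n + 1) * (‖y‖ ^ (-γ) * ((1 + ‖y‖) ^ (n + 1))⁻¹) := by
    intro y x' hx'
    have hx1 : 1 + ‖x'‖ ≤ 2 + ‖x‖ := by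
      have h1 : ‖x' - x‖ < 1 := by simpa [dist_eq_norm] using hx'
      have := norm_le_norm_add_norm_sub' x' x
      linarith
    rw [norm_smul, Real.norm_of_nonneg (hk0 y)]
    calc ‖y‖ ^ (-γ) * ‖fderiv ℝ ρ (x' - y)‖
        ≤ ‖y‖ ^ (-γ) * (C * ((1 + ‖x'‖) ^ (n + 1) * ((1 + ‖y‖) ^ (n + 1))⁻¹)) := by
          have := hk0 y
          have h2 := (hC1 (x' - y)).trans
            (mul_le_mul_of_nonneg_left (weight_shift x' y) hC)
          gcongr
      _ ≤ ‖y‖ ^ (-γ) * (C * ((2 + ‖x‖) ^ (n + 1) * ((1 + ‖y‖) ^ (n + 1))⁻¹)) := by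
          have := hk0 y
          gcongr
      _ = _ := by ring
  have hbi : Integrable (fun y : Rn n =>
      C * (2 + ‖x‖) ^ (n + 1) * (‖y‖ ^ (-γ) * ((1 + ‖y‖) ^ (n + 1))⁻¹)) := hK.const_mul _
  have hint : Integrable (fun y : Rn n => ‖y‖ ^ (-γ) * ρ (x - y)) := by
    refine Integrable.mono' (hK.const_mul (C * (1 + ‖x‖) ^ (n + 1))) (hm x)
      (Eventually.of_forall fun y => ?_)
    rw [norm_mul, Real.norm_of_nonneg (hk0 y), Real.norm_eq_abs]
    have := hk0 y
    have h2 := (hC0 (x - y)).trans (mul_le_mul_of_nonneg_left (weight_shift x y) hC)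
    calc ‖y‖ ^ (-γ) * |ρ (x - y)|
        ≤ ‖y‖ ^ (-γ) * (C * ((1 + ‖x‖) ^ (n + 1) * ((1 + ‖y‖) ^ (n + 1))⁻¹)) := by gcongr
      _ = _ := by ring
  have hint' : Integrable (fun y : Rn n => (‖y‖ ^ (-γ)) • fderiv ℝ ρ (x - y)) :=
    Integrable.mono' hbi hm'
      (Eventually.of_forall fun y => hb y x (Metric.mem_ball_self one_pos))
  have hd := hasFDerivAt_integral_of_dominated_of_fderiv_le (𝕜 := ℝ) (μ := (volume : Measure (Rn n)))
    (F := fun x' y => ‖y‖ ^ (-γ) * ρ (x' - y))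
    (F' := fun x' y => (‖y‖ ^ (-γ)) • fderiv ℝ ρ (x' - y)) (x₀ := x)
    (Metric.ball_mem_nhds x one_pos) (Eventually.of_forall hm) hint hm'
    (Eventually.of_forall hb) hbi
    (Eventually.of_forall fun y x' _ => by
      have h1 : HasFDerivAt ρ (fderiv ℝ ρ (x' - y)) (x' - y) :=
        (hρ.differentiable one_ne_zero _).hasFDerivAt
      have h2 : HasFDerivAt (fun x' => ρ (x' - y)) (fderiv ℝ ρ (x' - y)) x' :=
        h1.comp x' ((hasFDerivAt_id x').sub_const y)
      exact h2.const_mul _)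
  refine ⟨∫ y : Rn n, (‖y‖ ^ (-γ)) • fderiv ℝ ρ (x - y), ?_, fun v => ?_⟩
  · have : conv γ ρ = fun x => ∫ y : Rn n, ‖y‖ ^ (-γ) * ρ (x - y) := funext (conv_eq γ ρ)
    rw [this]
    exact hd
  · rw [ContinuousLinearMap.integral_apply hint', conv_eq]
    rfl

lemma normSq_hasFDerivAt {n : ℕ} (φ : SchwartzMap (Rn n) ℂ) (z : Rn n) :
    HasFDerivAt (fun y => Complex.normSq (φ y))
      (((2 : ℝ) • (innerSL ℝ (φ z))).comp (fderiv ℝ (⇑φ) z)) z := by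
  have h := (φ.differentiable z).hasFDerivAt.norm_sq
  have e : (fun y => Complex.normSq (φ y)) = fun y => ‖φ y‖ ^ 2 := by
    funext y; exact Complex.normSq_eq_norm_sq _
  rw [e]
  have e2 : ((2 : ℝ) • (innerSL ℝ (φ z))).comp (fderiv ℝ (⇑φ) z)
      = 2 • (innerSL ℝ (φ z)).comp (fderiv ℝ (⇑φ) z) := by
    ext v; simp; ring
  rw [e2]
  exact h

lemma fderiv_normSq_apply {n : ℕ} (φ : SchwartzMap (Rn n) ℂ) (z v : Rn n) :
    fderiv ℝ (fun y => Complex.normSq (φ y)) z v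
      = 2 * ((starRingEnd ℂ) (φ z) * fderiv ℝ (⇑φ) z v).re := by
  rw [(normSq_hasFDerivAt φ z).fderiv]
  simp [Complex.inner, mul_comm]

lemma hartree_hasFDerivAt {n : ℕ} (hn : 1 ≤ n) {γ : ℝ} (hγ0 : 0 < γ) (hγn : γ < n)
    (φ : SchwartzMap (Rn n) ℂ) (x : Rn n) :
    ∃ L : Rn n →L[ℝ] ℝ, HasFDerivAt (hartree γ (⇑φ)) L x ∧
      ∀ v, L v = conv γ (fun z => 2 * ((starRingEnd ℂ) (φ z) * fderiv ℝ (⇑φ) z v).re) x := by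
  obtain ⟨A, hA0, hA⟩ : ∃ A, 0 ≤ A ∧ ∀ z : Rn n, (1 + ‖z‖) ^ (n + 1) * ‖φ z‖ ≤ A := by
    refine ⟨2 ^ (n + 1) * (Finset.Iic (n + 1, 1)).sup
        (fun m => SchwartzMap.seminorm ℝ m.1 m.2) φ, by positivity, fun z => ?_⟩
    · have := SchwartzMap.one_add_le_sup_seminorm_apply (𝕜 := ℝ) (m := (n + 1, 1))
        (k := n + 1) (n := 0) le_rfl (by simp) φ z
      simpa using this
  obtain ⟨B, hB0, hB⟩ : ∃ B, 0 ≤ B ∧ ∀ z : Rn n, ‖φ z‖ ≤ B ∧ ‖fderiv ℝ (⇑φ) z‖ ≤ B := by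
    refine ⟨2 ^ 0 * (Finset.Iic (0, 1)).sup
        (fun m => SchwartzMap.seminorm ℝ m.1 m.2) φ, by positivity, fun z => ⟨?_, ?_⟩⟩
    · have := SchwartzMap.one_add_le_sup_seminorm_apply (𝕜 := ℝ) (m := (0, 1))
        (k := 0) (n := 0) le_rfl (by simp) φ z
      simpa using this
    · have := SchwartzMap.one_add_le_sup_seminorm_apply (𝕜 := ℝ) (m := (0, 1))
        (k := 0) (n := 1) le_rfl (by simp) φ z
      rw [norm_iteratedFDeriv_one] at this
      simpa using this
  have hA' : ∀ z : Rn n, ‖φ z‖ ≤ A * ((1 + ‖z‖) ^ (n + 1))⁻¹ := fun z => by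
    rw [← div_eq_mul_inv, le_div_iff₀ (by positivity), mul_comm]
    exact hA z
  have hcd : ContDiff ℝ 1 (fun y => Complex.normSq (φ y)) := by
    have e : (fun y => Complex.normSq (φ y)) = fun y => ‖φ y‖ ^ 2 := by
      funext y; exact Complex.normSq_eq_norm_sq _
    rw [e]
    exact (φ.smooth 1).norm_sq ℝ
  obtain ⟨L, hL, hLv⟩ := conv_hasFDerivAt hn hγ0 hγn (fun y => Complex.normSq (φ y)) hcd
    (2 * (A * B)) (fun z => by
      rw [abs_of_nonneg (Complex.normSq_nonneg _), Complex.normSq_eq_norm_sq]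
      have h1 := mul_le_mul (hA' z) (hB z).1 (norm_nonneg _) (by positivity)
      have h2 : 0 ≤ A * ((1 + ‖z‖) ^ (n + 1))⁻¹ * B := by positivity
      nlinarith) (fun z => by
      rw [(normSq_hasFDerivAt φ z).fderiv]
      refine (ContinuousLinearMap.opNorm_comp_le _ _).trans ?_
      rw [norm_smul, innerSL_apply_norm]
      have h1 := mul_le_mul (hA' z) (hB z).2 (norm_nonneg _) (by positivity)
      norm_num
      nlinarith) x
  refine ⟨L, hL, fun v => ?_⟩
  rw [hLv]
  simp only [fderiv_normSq_apply]

lemma conv_const_mul {n : ℕ} (γ c : ℝ) (ψ : Rn n → ℝ) (x : Rn n) :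
    conv γ (fun z => c * ψ z) x = c * conv γ ψ x := by
  unfold conv
  rw [← integral_const_mul]
  congr 1; funext y; ring

lemma grad_hartree {n : ℕ} (hn : 1 ≤ n) {γ : ℝ} (hγ0 : 0 < γ) (hγn : γ < n)
    (φ : SchwartzMap (Rn n) ℂ) (x : Rn n) (j : Fin n) :
    grad (fun y => ((hartree γ (⇑φ) y : ℝ) : ℂ) * φ y) x j
      = ((hartree γ (⇑φ) x : ℝ) : ℂ) * grad (⇑φ) x j
        + ((2 * conv γ (fun z => ((starRingEnd ℂ) (φ z) * grad (⇑φ) z j).re) x : ℝ) : ℂ)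
          * φ x := by
  obtain ⟨L, hL, hLv⟩ := hartree_hasFDerivAt hn hγ0 hγn φ x
  have h1 : HasFDerivAt (fun y => ((hartree γ (⇑φ) y : ℝ) : ℂ)) (Complex.ofRealCLM.comp L) x :=
    Complex.ofRealCLM.hasFDerivAt.comp x hL
  have h2 := h1.mul (φ.differentiable x).hasFDerivAt
  have h3 : fderiv ℝ (fun y => ((hartree γ (⇑φ) y : ℝ) : ℂ) * φ y) x = _ := h2.fderiv
  unfold grad
  rw [h3, ← conv_const_mul, ← hLv]
  simp [mul_comm]

lemma im_aux (a c : ℝ) (p q : ℂ) :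
    ((starRingEnd ℂ) p * ((a : ℂ) * p + Complex.I * (c : ℂ) * q)).im
      = c * ((starRingEnd ℂ) p * q).re := by
  simp
  ring

/-- the action of J^ε(t) (and of H^ε(t)) on the Hartree nonlinearity:
J^ε(t)((|x|^{−γ}∗|φ|²)φ) = (|x|^{−γ}∗|φ|²) J^ε(t)φ + 2i(|x|^{−γ}∗Im(φ̄ J^ε(t)φ))φ,
componentwise and pointwise. -/
theorem stmt3 (n : ℕ) (hn : 1 ≤ n) (γ : ℝ) (hγ0 : 0 < γ) (hγn : γ < n)
    (ε t : ℝ) (hε : 0 < ε) (φ : SchwartzMap (Rn n) ℂ) :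
    (∀ (x : Rn n) (j : Fin n),
      Jop ε t (fun y => ((hartree γ (⇑φ) y : ℝ) : ℂ) * φ y) x j
        = ((hartree γ (⇑φ) x : ℝ) : ℂ) * Jop ε t (⇑φ) x j
          + 2 * Complex.I *
            ((conv γ (fun z => ((starRingEnd ℂ) (φ z) * Jop ε t (⇑φ) z j).im) x : ℝ) : ℂ)
            * φ x)
    ∧ (∀ (x : Rn n) (j : Fin n),
      Hop ε t (fun y => ((hartree γ (⇑φ) y : ℝ) : ℂ) * φ y) x j
        = ((hartree γ (⇑φ) x : ℝ) : ℂ) * Hop ε t (⇑φ) x j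
          + 2 * Complex.I *
            ((conv γ (fun z => ((starRingEnd ℂ) (φ z) * Hop ε t (⇑φ) z j).im) x : ℝ) : ℂ)
            * φ x) := by
  have hJ : ∀ z j, Jop ε t (⇑φ) z j = ((z j / ε * Real.sin t : ℝ) : ℂ) * φ z
      + Complex.I * ((-Real.cos t : ℝ) : ℂ) * grad (⇑φ) z j := by
    intro z j; unfold Jop; push_cast; ring
  have hH : ∀ z j, Hop ε t (⇑φ) z j = ((z j * Real.cos t : ℝ) : ℂ) * φ z
      + Complex.I * ((ε * Real.sin t : ℝ) : ℂ) * grad (⇑φ) z j := by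
    intro z j; unfold Hop; push_cast; ring
  constructor
  · intro x j
    simp only [hJ, im_aux, conv_const_mul]
    unfold Jop
    rw [grad_hartree hn hγ0 hγn]
    push_cast
    ring
  · intro x j
    simp only [hH, im_aux, conv_const_mul]
    unfold Hop
    rw [grad_hartree hn hγ0 hγn]
    push_cast
    ring

end
end

section
/- Let n ≥ 2 and let (q,r) be an admissible pair, i.e. 2 ≤ r < 2n/(n−2) (2 ≤ r < ∞ if n = 2) and 2/q = δ(r) := n(1/2 − 1/r). Let I = [a,b] be a compact interval with 0 < a ≤ b < π. Then there exists a constant C = C(n,r,I), independent of ε, such that for every ε ∈ (0,1] and every Schwartz function φ : ℝⁿ → ℂ, the scaled homogeneous Strichartz estimate holds: ε^{1/q} ( ∫_I ‖U^ε(t)φ‖_{L^r(ℝⁿ)}^q dt )^{1/q} ≤ C ‖φ‖_{L²(ℝⁿ)}, where U^ε(t) is the harmonic-oscillator propagator given by Mehler's formula. -/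
open MeasureTheory Real Filter Topology
open scoped ENNReal NNReal ComplexConjugate

noncomputable section

lemma lint_rpow_Ioc {c A : ℝ} (hc : -1 < c) (hA : 0 ≤ A) :
    ∫⁻ x in Set.Ioc 0 A, ENNReal.ofReal (x ^ c) = ENNReal.ofReal (A ^ (c + 1) / (c + 1)) := by
  have hi := intervalIntegral.intervalIntegrable_rpow' (a := 0) (b := A) hc
  rw [intervalIntegrable_iff_integrableOn_Ioc_of_le hA] at hi
  rw [← ofReal_integral_eq_lintegral_ofReal hi]
  · rw [← intervalIntegral.integral_of_le hA, integral_rpow (Or.inl hc), zero_rpow (by linarith), sub_zero]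
  · filter_upwards [ae_restrict_mem measurableSet_Ioc] with x hx
    exact rpow_nonneg hx.1.le _

lemma hls_ker {δ : ℝ} (hδ0 : 0 < δ) (hδ1 : δ < 1) (t : ℝ) {F : Set ℝ} (hF : MeasurableSet F) {m : ℝ}
    (hm : 0 < m) (hFm : volume F ≤ ENNReal.ofReal m) :
    ∫⁻ s in F, ENNReal.ofReal (|t - s| ^ (-δ)) ≤
      ENNReal.ofReal ((2 / (1 - δ) + 1) * m ^ (1 - δ)) := by
  have hmeas : Measurable fun u : ℝ => ENNReal.ofReal (|u| ^ (-δ)) := by fun_prop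
  set S : Set ℝ := {s | |t - s| ≤ m} with hS
  have hSm : MeasurableSet S := measurableSet_le (by fun_prop) (by fun_prop)
  rw [← lintegral_inter_add_sdiff _ F hSm]
  have h1 : ∫⁻ s in F ∩ S, ENNReal.ofReal (|t - s| ^ (-δ)) ≤ ENNReal.ofReal (2 / (1 - δ) * m ^ (1 - δ)) := by
    calc ∫⁻ s in F ∩ S, ENNReal.ofReal (|t - s| ^ (-δ))
        ≤ ∫⁻ s in S, ENNReal.ofReal (|t - s| ^ (-δ)) := lintegral_mono_set Set.inter_subset_right
      _ = ∫⁻ s, Set.indicator {u : ℝ | |u| ≤ m} (fun u => ENNReal.ofReal (|u| ^ (-δ))) (t - s) := by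
          rw [← lintegral_indicator hSm]; rfl
      _ = ∫⁻ u, Set.indicator {u : ℝ | |u| ≤ m} (fun u => ENNReal.ofReal (|u| ^ (-δ))) u := 
          lintegral_sub_left_eq_self _ t
      _ = ∫⁻ u in {u : ℝ | |u| ≤ m}, ENNReal.ofReal (|u| ^ (-δ)) := 
          lintegral_indicator (measurableSet_le (by fun_prop) (by fun_prop)) _
      _ ≤ ∫⁻ u in (Set.Ioc 0 m ∪ {u | -u ∈ Set.Ioc 0 m}) ∪ {0}, ENNReal.ofReal (|u| ^ (-δ)) := by
          apply lintegral_mono_set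
          intro u hu
          simp only [Set.mem_ofPred_eq, abs_le] at hu
          rcases lt_trichotomy u 0 with h | h | h
          · left; right; exact ⟨by linarith, by linarith⟩
          · right; exact h
          · left; left; exact ⟨h, hu.2⟩
      _ ≤ ((∫⁻ u in Set.Ioc 0 m, ENNReal.ofReal (|u| ^ (-δ))) + ∫⁻ u in {u | -u ∈ Set.Ioc 0 m}, ENNReal.ofReal (|u| ^ (-δ))) + 
            ∫⁻ u in {0}, ENNReal.ofReal (|u| ^ (-δ)) := by
          refine (lintegral_union_le _ _ _).trans ?_
          gcongr
          exact lintegral_union_le _ _ _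
      _ = ENNReal.ofReal (2 / (1 - δ) * m ^ (1 - δ)) := by
          have e1 : ∫⁻ u in Set.Ioc 0 m, ENNReal.ofReal (|u| ^ (-δ)) = ENNReal.ofReal (m ^ (-δ + 1) / (-δ + 1)) := by
            rw [← lint_rpow_Ioc (by linarith) hm.le]
            apply setLIntegral_congr_fun measurableSet_Ioc
            intro u hu
            simp only [abs_of_pos hu.1]
          have e2 : ∫⁻ u in {u | -u ∈ Set.Ioc 0 m}, ENNReal.ofReal (|u| ^ (-δ)) = ∫⁻ u in Set.Ioc 0 m, ENNReal.ofReal (|u| ^ (-δ)) := by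
            have := (Measure.measurePreserving_neg (volume : Measure ℝ)).setLIntegral_comp_preimage (s := Set.Ioc 0 m) measurableSet_Ioc hmeas
            rw [← this]
            simp only [abs_neg]; rfl
          rw [e2, e1, Measure.restrict_singleton]
          simp only [volume_singleton, zero_smul, lintegral_zero_measure, add_zero]
          rw [← ENNReal.ofReal_add (by have := sub_pos.2 hδ1; rw [neg_add_eq_sub]; positivity) (by have := sub_pos.2 hδ1; rw [neg_add_eq_sub]; positivity)]
          congr 1
          rw [neg_add_eq_sub]; ring
  have h2 : ∫⁻ s in F \ S, ENNReal.ofReal (|t - s| ^ (-δ)) ≤ ENNReal.ofReal (m ^ (1 - δ)) := by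
    calc ∫⁻ s in F \ S, ENNReal.ofReal (|t - s| ^ (-δ)) ≤ ∫⁻ s in F \ S, ENNReal.ofReal (m ^ (-δ)) := by
          apply setLIntegral_mono' (hF.diff hSm)
          intro s hs
          apply ENNReal.ofReal_le_ofReal
          have : m < |t - s| := not_le.1 hs.2
          exact rpow_le_rpow_of_nonpos hm this.le (by linarith)
      _ = ENNReal.ofReal (m ^ (-δ)) * volume (F \ S) := by simp
      _ ≤ ENNReal.ofReal (m ^ (-δ)) * ENNReal.ofReal m := by
          gcongr; exact (measure_mono Set.sdiff_subset).trans hFm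
      _ = ENNReal.ofReal (m ^ (1 - δ)) := by
          rw [← ENNReal.ofReal_mul (by positivity)]
          congr 1
          rw [sub_eq_neg_add, rpow_add hm, rpow_one]
  refine (add_le_add h1 h2).trans ?_
  have := sub_pos.2 hδ1
  rw [← ENNReal.ofReal_add (by positivity) (by positivity)]
  apply ENNReal.ofReal_le_ofReal
  ring_nf; rfl

/-- One-sided pointwise estimate. -/
lemma hls_pt {δ p : ℝ} (hδ0 : 0 < δ) (hδ1 : δ < 1) (hp : p = 2 / (2 - δ)) {f : ℝ → ℝ} (hf : Measurable f)
    (hf0 : ∀ s, 0 ≤ f s) {X : ℝ} (hX : 0 < X) (hfX : ∫⁻ s, ENNReal.ofReal (f s ^ p) = ENNReal.ofReal X) (t : ℝ) :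
    ∫⁻ s in {s | f s ≤ f t}, ENNReal.ofReal (f s) * ENNReal.ofReal (|t - s| ^ (-δ)) ≤
      ENNReal.ofReal ((2 / (1 - δ) + 1) * X ^ (1 - δ) * ((f t) ^ (p - 1) / (p - 1))) := by
  have hp1 : 1 < p := by rw [hp, lt_div_iff₀ (by linarith)]; linarith
  have hp2 : p - 1 = -(p * (1 - δ)) + 1 := by
    have : (2 - δ) ≠ 0 := by linarith
    rw [hp]; field_simp; ring
  have hk : Measurable fun s : ℝ => ENNReal.ofReal (|t - s| ^ (-δ)) := by fun_prop
  have hL : MeasurableSet {s | f s ≤ f t} := measurableSet_le hf measurable_const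
  set ν : Measure ℝ := (volume.restrict {s | f s ≤ f t}).withDensity (fun s => ENNReal.ofReal (|t - s| ^ (-δ)))
  have e : ∫⁻ s in {s | f s ≤ f t}, ENNReal.ofReal (f s) * ENNReal.ofReal (|t - s| ^ (-δ)) = ∫⁻ s, ENNReal.ofReal (f s) ∂ν := by
    rw [lintegral_withDensity_eq_lintegral_mul _ hk (by fun_prop)]
    simp only [Pi.mul_apply, mul_comm]
  rw [e, lintegral_eq_lintegral_meas_lt ν (Eventually.of_forall hf0) hf.aemeasurable]
  have key : ∀ b ∈ Set.Ioi (0:ℝ), ν {s | b < f s} ≤ (Set.Ioc 0 (f t)).indicator 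
      (fun b => ENNReal.ofReal ((2 / (1 - δ) + 1) * X ^ (1 - δ)) * ENNReal.ofReal (b ^ (-(p * (1 - δ))))) b := by
    intro b hb
    have hb0 : 0 < b := hb
    have hm : MeasurableSet {s | b < f s} := measurableSet_lt measurable_const hf
    rw [withDensity_apply _ hm]
    by_cases hbt : b ≤ f t
    · rw [Set.indicator_of_mem (show b ∈ Set.Ioc 0 (f t) from ⟨hb0, hbt⟩)]
      have hv : volume {s | b < f s} ≤ ENNReal.ofReal (X / b ^ p) := by
        have hbp : 0 < b ^ p := by positivity
        rw [ENNReal.ofReal_div_of_pos hbp, ← hfX]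
        refine le_trans ?_ (meas_ge_le_lintegral_div (by fun_prop) (by simpa using hbp) (by simp))
        apply measure_mono
        intro s hs
        exact ENNReal.ofReal_le_ofReal (rpow_le_rpow hb0.le (le_of_lt hs) (by linarith))
      rw [Measure.restrict_restrict hm]
      refine (lintegral_mono_set Set.inter_subset_left).trans ?_
      refine (hls_ker hδ0 hδ1 t hm (by positivity) hv).trans ?_
      have h1 := sub_pos.2 hδ1
      rw [← ENNReal.ofReal_mul (by positivity)]
      apply ENNReal.ofReal_le_ofReal
      rw [div_rpow hX.le (by positivity), ← rpow_mul hb0.le, rpow_neg hb0.le]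
      apply le_of_eq; ring
    · rw [Measure.restrict_restrict hm]
      have : {s | b < f s} ∩ {s | f s ≤ f t} = ∅ := by
        ext s; simp only [Set.mem_inter_iff, Set.mem_ofPred_eq, Set.mem_empty_iff_false, iff_false]
        intro h; linarith [h.1, h.2]
      rw [this]; simp
  refine (setLIntegral_mono' measurableSet_Ioi key).trans ?_
  rw [lintegral_indicator measurableSet_Ioc]
  refine (lintegral_mono' (Measure.restrict_mono le_rfl Measure.restrict_le_self) le_rfl).trans ?_
  rw [lintegral_const_mul _ (by fun_prop), lint_rpow_Ioc (by linarith) (hf0 t), ← hp2, ← ENNReal.ofReal_mul]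
  have h1 := sub_pos.2 hδ1
  positivity

/-- Diagonal Hardy–Littlewood–Sobolev inequality on the line. -/
lemma hls {δ p : ℝ} (hδ0 : 0 < δ) (hδ1 : δ < 1) (hp : p = 2 / (2 - δ)) :
    ∃ C : ℝ, 0 < C ∧ ∀ f : ℝ → ℝ, Measurable f → (∀ s, 0 ≤ f s) → 
      ∀ X : ℝ, 0 < X → ∫⁻ s, ENNReal.ofReal (f s ^ p) = ENNReal.ofReal X →
      ∫⁻ t, ∫⁻ s, ENNReal.ofReal (f t) * ENNReal.ofReal (f s) * ENNReal.ofReal (|t - s| ^ (-δ)) ≤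
        ENNReal.ofReal (C * X ^ (2 - δ)) := by
  have hp1 : 1 < p := by rw [hp, lt_div_iff₀ (by linarith)]; linarith
  have hp1' := sub_pos.2 hp1
  have hδ1' := sub_pos.2 hδ1
  set c : ℝ := (2 / (1 - δ) + 1) / (p - 1) with hc
  have hc0 : 0 < c := by positivity
  refine ⟨2 * c, by positivity, fun f hf hf0 X hX hfX => ?_⟩
  set g : ℝ → ℝ → ℝ≥0∞ := fun t s => ENNReal.ofReal (f t) * ENNReal.ofReal (f s) * ENNReal.ofReal (|t - s| ^ (-δ)) with hg
  have hgm : Measurable (Function.uncurry g) := by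
    simp only [hg, Function.uncurry]; fun_prop
  have hgs : ∀ t s, g t s = g s t := by
    intro t s; simp only [hg, abs_sub_comm t s, mul_comm (ENNReal.ofReal (f t))]
  set D : ℝ → ℝ → ℝ≥0∞ := fun t s => Set.indicator {s | f s ≤ f t} (g t) s with hD
  have hDm : Measurable (Function.uncurry D) := by
    have : Function.uncurry D = Set.indicator {z : ℝ × ℝ | f z.2 ≤ f z.1} (Function.uncurry g) := by
      ext z; rcases z with ⟨t, s⟩; simp only [hD, Function.uncurry, Set.indicator]; rfl
    rw [this]
    exact hgm.indicator (measurableSet_le (by fun_prop) (by fun_prop))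
  have hle : ∀ t s, g t s ≤ D t s + D s t := by
    intro t s
    rcases le_total (f s) (f t) with h | h
    · have : D t s = g t s := Set.indicator_of_mem (s := {s | f s ≤ f t}) h _
      rw [this]; exact le_self_add
    · have : D s t = g s t := Set.indicator_of_mem (s := {t | f t ≤ f s}) h _
      rw [this, hgs]; exact le_add_self
  have hD1 : ∫⁻ t, ∫⁻ s, D t s ≤ ENNReal.ofReal (c * X ^ (2 - δ)) := by
    calc ∫⁻ t, ∫⁻ s, D t s ≤ ∫⁻ t, ENNReal.ofReal (c * X ^ (1 - δ)) * ENNReal.ofReal (f t ^ p) := by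
          apply lintegral_mono
          intro t
          simp only [hD]
          rw [lintegral_indicator (measurableSet_le hf measurable_const)]
          simp only [hg, mul_assoc]
          rw [lintegral_const_mul _ (by fun_prop)]
          refine (mul_le_mul_right (hls_pt hδ0 hδ1 hp hf hf0 hX hfX t) _).trans ?_
          rw [← ENNReal.ofReal_mul (hf0 t), ← ENNReal.ofReal_mul (by positivity)]
          apply ENNReal.ofReal_le_ofReal
          apply le_of_eq
          have : f t ^ p = f t * f t ^ (p - 1) := by
            rcases (hf0 t).eq_or_lt with h | h
            · rw [← h, zero_rpow (by linarith)]; simp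
            · rw [rpow_sub h, rpow_one]; field_simp
          rw [this, hc]; ring
      _ = ENNReal.ofReal (c * X ^ (2 - δ)) := by
          rw [lintegral_const_mul _ (by fun_prop), hfX, ← ENNReal.ofReal_mul (by positivity)]
          congr 1
          rw [show 2 - δ = (1 - δ) + 1 by ring, rpow_add hX, rpow_one]; ring
  have hDsm : Measurable (Function.uncurry fun t s => D s t) := hDm.comp measurable_swap
  calc ∫⁻ t, ∫⁻ s, g t s ≤ ∫⁻ t, ∫⁻ s, (D t s + D s t) := lintegral_mono fun t => lintegral_mono fun s => hle t s
    _ = ∫⁻ t, ((∫⁻ s, D t s) + ∫⁻ s, D s t) := by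
        congr 1; ext t; rw [lintegral_add_left]; exact hDm.of_uncurry_left
    _ = (∫⁻ t, ∫⁻ s, D t s) + ∫⁻ t, ∫⁻ s, D s t := lintegral_add_left hDm.lintegral_prod_right' _
    _ = (∫⁻ t, ∫⁻ s, D t s) + ∫⁻ t, ∫⁻ s, D t s := by
        congr 1
        rw [lintegral_lintegral_swap]
        exact hDsm.aemeasurable
    _ ≤ ENNReal.ofReal (c * X ^ (2 - δ)) + ENNReal.ofReal (c * X ^ (2 - δ)) := add_le_add hD1 hD1
    _ = ENNReal.ofReal (2 * c * X ^ (2 - δ)) := by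
        rw [← ENNReal.ofReal_add (by positivity) (by positivity)]; congr 1; ring


/-- Marcinkiewicz-type interpolation between an `L¹ → L^∞` and an `L² → L²` bound. -/
lemma marcin {α : Type*} [MeasurableSpace α] (μ : Measure α) [SFinite μ] {r p : ℝ} (hr : 2 < r) (hp : p = r / (r - 1))
    {M X : ℝ} (hM : 0 < M) (hX : 0 < X) {f Tf : α → ℂ} (hf : Measurable f) (hTf : Measurable Tf)
    (hfX : ∫⁻ x, ENNReal.ofReal (‖f x‖ ^ p) ∂μ = ENNReal.ofReal X)
    (H : ∀ l : ℝ, 0 < l → ∃ u v : α → ℂ, Measurable v ∧ (∀ x, Tf x = u x + v x) ∧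
      (∀ x, ENNReal.ofReal ‖u x‖ ≤ ENNReal.ofReal M * ∫⁻ x in {x | l < ‖f x‖}, ENNReal.ofReal ‖f x‖ ∂μ) ∧
      ∫⁻ x, ENNReal.ofReal (‖v x‖ ^ 2) ∂μ ≤ ∫⁻ x in {x | ‖f x‖ ≤ l}, ENNReal.ofReal (‖f x‖ ^ 2) ∂μ) :
    ∫⁻ x, ENNReal.ofReal (‖Tf x‖ ^ r) ∂μ ≤
      ENNReal.ofReal ((4 * r * 2 ^ (r - 2) / (r - 2)) * M ^ (r - 2) * X ^ (r - 1)) := by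
  have hr1 : 0 < r - 1 := by linarith
  have hr2 : 0 < r - 2 := by linarith
  have hp1 : 1 < p := by rw [hp, lt_div_iff₀ hr1]; linarith
  set lam : ℝ → ℝ := fun a => (2 * M * X / a) ^ (r - 1) with hlam
  have hlam_meas : Measurable lam := by fun_prop
  have hlevel : ∀ a ∈ Set.Ioi (0:ℝ), μ {x | a < ‖Tf x‖} * ENNReal.ofReal (a ^ (r - 1)) ≤
      ∫⁻ x, Set.indicator {x | ‖f x‖ ≤ lam a} (fun x => ENNReal.ofReal (‖f x‖ ^ 2) * ENNReal.ofReal (4 * a ^ (r - 3))) x ∂μ := by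
    intro a ha
    have ha0 : 0 < a := ha
    have hl0 : 0 < lam a := by simp only [hlam]; positivity
    obtain ⟨u, v, hv, huv, hu, hv2⟩ := H (lam a) hl0
    have hm1 : MeasurableSet {x | lam a < ‖f x‖} := measurableSet_lt measurable_const hf.norm
    have hm2 : MeasurableSet {x | ‖f x‖ ≤ lam a} := measurableSet_le hf.norm measurable_const
    have hu' : ∀ x, ‖u x‖ ≤ a / 2 := by
      intro x
      have h1 : ∫⁻ x in {x | lam a < ‖f x‖}, ENNReal.ofReal ‖f x‖ ∂μ ≤ ENNReal.ofReal (a / (2 * M)) := by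
        calc ∫⁻ x in {x | lam a < ‖f x‖}, ENNReal.ofReal ‖f x‖ ∂μ 
            ≤ ∫⁻ x in {x | lam a < ‖f x‖}, ENNReal.ofReal (lam a ^ (1 - p)) * ENNReal.ofReal (‖f x‖ ^ p) ∂μ := by
              apply setLIntegral_mono' hm1
              intro x hx
              rw [← ENNReal.ofReal_mul (by positivity)]
              apply ENNReal.ofReal_le_ofReal
              have hx' : lam a < ‖f x‖ := hx
              have hfx : 0 < ‖f x‖ := hl0.trans hx'
              have h2 : ‖f x‖ ^ (1 - p) ≤ lam a ^ (1 - p) := rpow_le_rpow_of_nonpos hl0 hx'.le (by linarith)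
              calc ‖f x‖ = ‖f x‖ ^ (1 - p) * ‖f x‖ ^ p := by rw [← rpow_add hfx]; simp
                _ ≤ _ := by gcongr
          _ ≤ ∫⁻ x, ENNReal.ofReal (lam a ^ (1 - p)) * ENNReal.ofReal (‖f x‖ ^ p) ∂μ := setLIntegral_le_lintegral _ _
          _ = ENNReal.ofReal (a / (2 * M)) := by
              rw [lintegral_const_mul _ (by fun_prop), hfX, ← ENNReal.ofReal_mul (by positivity)]
              congr 1
              simp only [hlam]
              rw [← rpow_mul (by positivity), show (r - 1) * (1 - p) = -1 by rw [hp]; field_simp; ring, rpow_neg_one]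
              field_simp
      have h3 := (hu x).trans (mul_le_mul_right h1 _)
      rw [← ENNReal.ofReal_mul hM.le, ENNReal.ofReal_le_ofReal_iff (by positivity)] at h3
      refine h3.trans (le_of_eq (by field_simp))
    have h4 : μ {x | a < ‖Tf x‖} ≤ ENNReal.ofReal (4 / a ^ 2) * ∫⁻ x in {x | ‖f x‖ ≤ lam a}, ENNReal.ofReal (‖f x‖ ^ 2) ∂μ := by
      calc μ {x | a < ‖Tf x‖} ≤ μ {x | ENNReal.ofReal ((a / 2) ^ 2) ≤ ENNReal.ofReal (‖v x‖ ^ 2)} := by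
            apply measure_mono
            intro x hx
            have hx' : a < ‖Tf x‖ := hx
            have : ‖Tf x‖ ≤ ‖u x‖ + ‖v x‖ := by rw [huv]; exact norm_add_le _ _
            have h5 : a / 2 ≤ ‖v x‖ := by linarith [hu' x]
            exact ENNReal.ofReal_le_ofReal (by gcongr)
        _ ≤ (∫⁻ x, ENNReal.ofReal (‖v x‖ ^ 2) ∂μ) / ENNReal.ofReal ((a / 2) ^ 2) :=
            meas_ge_le_lintegral_div (by fun_prop) (by simpa using ha0.ne') (by simp)
        _ ≤ (∫⁻ x in {x | ‖f x‖ ≤ lam a}, ENNReal.ofReal (‖f x‖ ^ 2) ∂μ) / ENNReal.ofReal ((a / 2) ^ 2) := by gcongr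
        _ = _ := by
            rw [ENNReal.div_eq_inv_mul, ← ENNReal.ofReal_inv_of_pos (by positivity)]
            congr 2; field_simp; norm_num
    rw [lintegral_indicator hm2, lintegral_mul_const _ (by fun_prop)]
    refine (mul_le_mul_left h4 _).trans (le_of_eq ?_)
    rw [mul_comm (ENNReal.ofReal (4 / a ^ 2)), mul_assoc, ← ENNReal.ofReal_mul (by positivity)]
    congr 2
    rw [show r - 3 = (r - 1) - 2 by ring, rpow_sub ha0 (r - 1) 2, rpow_two]
    ring
  rw [lintegral_rpow_eq_lintegral_meas_lt_mul μ (Eventually.of_forall fun x => norm_nonneg _) hTf.norm.aemeasurable (by linarith)]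
  have hmeas2 : Measurable (Function.uncurry fun (a : ℝ) (x : α) => Set.indicator {x | ‖f x‖ ≤ lam a} (fun x => ENNReal.ofReal (‖f x‖ ^ 2) * ENNReal.ofReal (4 * a ^ (r - 3))) x) := by
    have : (Function.uncurry fun (a : ℝ) (x : α) => Set.indicator {x | ‖f x‖ ≤ lam a} (fun x => ENNReal.ofReal (‖f x‖ ^ 2) * ENNReal.ofReal (4 * a ^ (r - 3))) x)
      = Set.indicator {z : ℝ × α | ‖f z.2‖ ≤ lam z.1} (fun z => ENNReal.ofReal (‖f z.2‖ ^ 2) * ENNReal.ofReal (4 * z.1 ^ (r - 3))) := by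
      ext z; rcases z with ⟨t, s⟩; simp only [Function.uncurry, Set.indicator]; rfl
    rw [this]
    exact Measurable.indicator (by fun_prop) (measurableSet_le (by fun_prop) (by fun_prop))
  have hin : ∀ x, ∫⁻ a in Set.Ioi (0:ℝ), Set.indicator {x | ‖f x‖ ≤ lam a} (fun x => ENNReal.ofReal (‖f x‖ ^ 2) * ENNReal.ofReal (4 * a ^ (r - 3))) x ≤ 
      ENNReal.ofReal (4 * (2 * M * X) ^ (r - 2) / (r - 2)) * ENNReal.ofReal (‖f x‖ ^ p) := by
    intro x
    rcases (norm_nonneg (f x)).eq_or_lt with h0 | h0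
    · refine le_of_eq_of_le ?_ (zero_le : (0:ℝ≥0∞) ≤ _)
      simp [Set.indicator, ← h0]
    set A : ℝ := 2 * M * X * ‖f x‖ ^ (-(1 / (r - 1))) with hA
    have hA0 : 0 < A := by positivity
    calc ∫⁻ a in Set.Ioi (0:ℝ), Set.indicator {x | ‖f x‖ ≤ lam a} (fun x => ENNReal.ofReal (‖f x‖ ^ 2) * ENNReal.ofReal (4 * a ^ (r - 3))) x
        ≤ ∫⁻ a in Set.Ioi (0:ℝ), Set.indicator (Set.Ioc 0 A) (fun a => ENNReal.ofReal (4 * ‖f x‖ ^ 2) * ENNReal.ofReal (a ^ (r - 3))) a := by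
          apply setLIntegral_mono' measurableSet_Ioi
          intro a ha
          have ha0 : 0 < a := ha
          by_cases h : ‖f x‖ ≤ lam a
          · have hmem : a ∈ Set.Ioc 0 A := by
              refine ⟨ha0, ?_⟩
              have h1 : ‖f x‖ ^ (1 / (r - 1)) ≤ 2 * M * X / a := by
                have := rpow_le_rpow h0.le h (by positivity : 0 ≤ 1 / (r - 1))
                simp only [hlam] at this
                rwa [← rpow_mul (by positivity), mul_one_div_cancel hr1.ne', rpow_one] at this
              rw [le_div_iff₀ ha0] at h1
              rw [hA, rpow_neg h0.le, ← div_eq_mul_inv, le_div_iff₀ (by positivity)]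
              linarith
            rw [Set.indicator_of_mem hmem, Set.indicator_of_mem (s := {x | ‖f x‖ ≤ lam a}) h,
              ← ENNReal.ofReal_mul (by positivity), ← ENNReal.ofReal_mul (by positivity)]
            exact ENNReal.ofReal_le_ofReal (le_of_eq (by ring))
          · rw [Set.indicator_of_notMem (s := {x | ‖f x‖ ≤ lam a}) h]; exact zero_le
      _ ≤ ∫⁻ a in Set.Ioc 0 A, ENNReal.ofReal (4 * ‖f x‖ ^ 2) * ENNReal.ofReal (a ^ (r - 3)) := by
          rw [lintegral_indicator measurableSet_Ioc]
          exact lintegral_mono' (Measure.restrict_mono le_rfl Measure.restrict_le_self) le_rfl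
      _ = _ := by
          rw [lintegral_const_mul _ (by fun_prop), lint_rpow_Ioc (by linarith) hA0.le, 
            ← ENNReal.ofReal_mul (by positivity), ← ENNReal.ofReal_mul (by positivity)]
          congr 1
          rw [hA, show r - 3 + 1 = r - 2 by ring, mul_rpow (by positivity) (by positivity), ← rpow_mul h0.le]
          have : ‖f x‖ ^ p = ‖f x‖ ^ 2 * ‖f x‖ ^ (-(1 / (r - 1)) * (r - 2)) := by
            rw [← rpow_two, ← rpow_add h0]; congr 1; rw [hp]; field_simp; ring
          rw [this]; ring
  calc _ ≤ ENNReal.ofReal r * ∫⁻ a in Set.Ioi (0:ℝ), ∫⁻ x, Set.indicator {x | ‖f x‖ ≤ lam a} (fun x => ENNReal.ofReal (‖f x‖ ^ 2) * ENNReal.ofReal (4 * a ^ (r - 3))) x ∂μ := by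
        exact mul_le_mul_right (setLIntegral_mono' measurableSet_Ioi hlevel) _
    _ = ENNReal.ofReal r * ∫⁻ x, (∫⁻ a in Set.Ioi (0:ℝ), Set.indicator {x | ‖f x‖ ≤ lam a} (fun x => ENNReal.ofReal (‖f x‖ ^ 2) * ENNReal.ofReal (4 * a ^ (r - 3))) x) ∂μ := by
        rw [lintegral_lintegral_swap hmeas2.aemeasurable]
    _ ≤ ENNReal.ofReal r * ∫⁻ x, ENNReal.ofReal (4 * (2 * M * X) ^ (r - 2) / (r - 2)) * ENNReal.ofReal (‖f x‖ ^ p) ∂μ := by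
        exact mul_le_mul_right (lintegral_mono hin) _
    _ = _ := by
        rw [lintegral_const_mul _ (by fun_prop), hfX, ← ENNReal.ofReal_mul (by positivity), ← ENNReal.ofReal_mul (by positivity)]
        congr 1
        rw [mul_rpow (by positivity) hX.le, mul_rpow (by positivity) hM.le, show r - 1 = (r - 2) + 1 by ring, rpow_add hX, rpow_one]
        ring


section FourierPart
open scoped FourierTransform

variable {V : Type*} [NormedAddCommGroup V] [InnerProductSpace ℝ V] [FiniteDimensional ℝ V]
  [MeasurableSpace V] [BorelSpace V]

lemma pairing {u h : V → ℂ} (hu : Integrable u) (hh : Integrable h) :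
    ∫ y, u y * conj (𝓕 h y) = ∫ z, 𝓕⁻ u z * conj (h z) := by
  have := VectorFourier.integral_sesq_fourierIntegral_eq_neg_flip (innerSL ℂ (E := ℂ))
    (L := innerₗ V) continuous_fourierChar continuous_inner hh hu
  simp only [innerSL_apply_apply, RCLike.inner_apply, flip_innerₗ] at this
  exact this

/-- The complex Gaussian. -/
def gb (b : ℂ) (y : V) : ℂ := Complex.exp (-(π * b) * (‖y‖ : ℂ) ^ 2)

lemma norm_gb (b : ℂ) (y : V) : ‖gb b y‖ = Real.exp (-(π * b.re) * ‖y‖ ^ 2) := by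
  rw [gb, Complex.norm_exp]
  congr 1
  rw [← Complex.ofReal_pow, Complex.re_mul_ofReal]
  simp

lemma continuous_gb (b : ℂ) : Continuous (gb b : V → ℂ) := by
  unfold gb; fun_prop

lemma integrable_gb {b : ℂ} (hb : 0 < b.re) : Integrable (gb b : V → ℂ) := by
  have := GaussianFourier.integrable_cexp_neg_mul_sq_norm_add (V := V) (b := π * b) (by simp; positivity) 0 0
  unfold gb
  simpa using this

lemma norm_gb_le {b : ℂ} (hb : 0 < b.re) (y : V) : ‖gb b y‖ ≤ 1 := by
  rw [norm_gb, exp_le_one_iff]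
  have := mul_nonneg (mul_nonneg pi_pos.le hb.le) (sq_nonneg ‖y‖)
  linarith

/-- kernel -/
def Kb (b : ℂ) (w : V) : ℂ := (1 / b) ^ ((Module.finrank ℝ V : ℂ) / 2) * Complex.exp (-π * (‖w‖ : ℂ) ^ 2 / b)

lemma norm_Kb {b : ℂ} (hb : 0 < b.re) (w : V) :
    ‖Kb b w‖ = ‖b‖ ^ (-(Module.finrank ℝ V : ℝ) / 2) * Real.exp (-π * ‖w‖ ^ 2 * (b.re / ‖b‖ ^ 2)) := by
  have hb0 : b ≠ 0 := by rintro rfl; simp at hb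
  have hn : 0 < ‖b‖ := norm_pos_iff.2 hb0
  rw [Kb, norm_mul]
  congr 1
  · have : ((Module.finrank ℝ V : ℂ) / 2) = (((Module.finrank ℝ V : ℝ) / 2 : ℝ) : ℂ) := by push_cast; rfl
    rw [this, Complex.norm_cpow_of_ne_zero (by simpa using hb0)]
    simp only [Complex.ofReal_re, Complex.ofReal_im, mul_zero, Real.exp_zero, div_one, norm_div, norm_one]
    rw [one_div, inv_rpow hn.le, ← rpow_neg hn.le, neg_div]
  · rw [Complex.norm_exp]
    congr 1
    have : -(π : ℂ) * (‖w‖ : ℂ) ^ 2 / b = ((-π * ‖w‖ ^ 2 : ℝ) : ℂ) * b⁻¹ := by push_cast; rw [div_eq_mul_inv]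
    rw [this, Complex.re_ofReal_mul, Complex.inv_re, Complex.normSq_eq_norm_sq]

lemma norm_Kb_le {b : ℂ} (hb : 0 < b.re) (w : V) :
    ‖Kb b w‖ ≤ ‖b‖ ^ (-(Module.finrank ℝ V : ℝ) / 2) := by
  rw [norm_Kb hb]
  apply mul_le_of_le_one_right (by positivity)
  rw [exp_le_one_iff]
  have : 0 ≤ π * ‖w‖ ^ 2 * (b.re / ‖b‖ ^ 2) := by positivity
  linarith

lemma norm_fourier_le {f : V → ℂ} (y : V) : ‖𝓕 f y‖ ≤ ∫ x, ‖f x‖ :=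
  VectorFourier.norm_fourierIntegral_le_integral_norm _ _ _ _ _

lemma norm_fourierInv_le {f : V → ℂ} (y : V) : ‖𝓕⁻ f y‖ ≤ ∫ x, ‖f x‖ :=
  VectorFourier.norm_fourierIntegral_le_integral_norm _ _ _ _ _

lemma continuous_fourier' {f : V → ℂ} (hf : Integrable f) : Continuous (𝓕 f) :=
  VectorFourier.fourierIntegral_continuous continuous_fourierChar (L := innerₗ V) continuous_inner hf

lemma continuous_fourierInv' {f : V → ℂ} (hf : Integrable f) : Continuous (𝓕⁻ f) := by
  have : 𝓕⁻ f = fun w => 𝓕 f (-w) := by ext w; exact Real.fourierInv_eq_fourier_neg f w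
  rw [this]
  exact (continuous_fourier' hf).comp continuous_neg

lemma integrable_gb_mul {b : ℂ} (hb : 0 < b.re) {f : V → ℂ} (hf : Integrable f) :
    Integrable (fun y => gb b y * 𝓕 f y) := by
  refine (integrable_gb hb).mul_bdd (c := ∫ x, ‖f x‖) (continuous_fourier' hf).aestronglyMeasurable ?_
  exact Eventually.of_forall fun y => norm_fourier_le y

/-- Regularised Schrödinger operator. -/
def Sop (b : ℂ) (f : V → ℂ) : V → ℂ := 𝓕⁻ (fun y => gb b y * 𝓕 f y)

lemma continuous_Sop {b : ℂ} (hb : 0 < b.re) {f : V → ℂ} (hf : Integrable f) : Continuous (Sop b f) :=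
  continuous_fourierInv' (integrable_gb_mul hb hf)

lemma Sop_eq {b : ℂ} (hb : 0 < b.re) {f : V → ℂ} (hf : Integrable f) (z : V) :
    Sop b f z = ∫ x, f x * Kb b (z - x) := by
  have hb0 : b ≠ 0 := by rintro rfl; simp at hb
  have h1 : 0 < ((π : ℂ) * b).re := by simp; positivity
  set g : V → ℂ := fun v => Complex.exp (-(π * b) * ‖v‖ ^ 2 + 2 * π * Complex.I * (inner ℝ z v : ℝ)) with hg
  have hgi : Integrable g := by
    have := GaussianFourier.integrable_cexp_neg_mul_sq_norm_add (V := V) (b := π * b) h1 (2 * π * Complex.I) z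
    exact this
  have hfl := VectorFourier.integral_fourierIntegral_smul_eq_flip (L := innerₗ V) (f := f) (g := g)
    continuous_fourierChar continuous_inner hf hgi
  simp only [flip_innerₗ, smul_eq_mul] at hfl
  change ∫ y, 𝓕 f y * g y = ∫ x, f x * 𝓕 g x at hfl
  have h2 : Sop b f z = ∫ y, 𝓕 f y * g y := by
    rw [Sop, Real.fourierInv_eq']
    congr 1
    ext y
    rw [hg, smul_eq_mul, gb]
    simp only
    rw [Complex.exp_add, real_inner_comm]
    have : (((2 * π * inner ℝ z y : ℝ) : ℂ) * Complex.I) = 2 * π * Complex.I * (inner ℝ z y : ℝ) := by push_cast; ring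
    rw [this]; ring
  rw [h2, hfl]
  congr 1
  ext x
  rw [hg, fourier_gaussian_innerProductSpace' h1, Kb]
  have hpi : (π : ℂ) ≠ 0 := by exact_mod_cast pi_ne_zero
  congr 3
  · rw [div_mul_eq_div_div, div_self hpi]
  · field_simp

lemma norm_Sop_le {b : ℂ} (hb : 0 < b.re) {f : V → ℂ} (hf : Integrable f) (z : V) :
    ‖Sop b f z‖ ≤ ‖b‖ ^ (-(Module.finrank ℝ V : ℝ) / 2) * ∫ x, ‖f x‖ := by
  rw [Sop_eq hb hf, ← integral_const_mul]
  apply norm_integral_le_of_norm_le (hf.norm.const_mul _)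
  refine Eventually.of_forall fun x => ?_
  rw [norm_mul, mul_comm]
  exact mul_le_mul_of_nonneg_right (norm_Kb_le hb _) (norm_nonneg _)

lemma lint_Kb {η : ℝ} (hη : 0 < η) : ∫⁻ w : V, ENNReal.ofReal ‖Kb (η : ℂ) w‖ = 1 := by
  have h : ∀ w : V, ‖Kb (η : ℂ) w‖ = η ^ (-(Module.finrank ℝ V : ℝ) / 2) * Real.exp (-(π / η) * ‖w‖ ^ 2) := by
    intro w
    rw [norm_Kb (by simpa using hη)]
    simp only [Complex.norm_real, Complex.ofReal_re, norm_eq_abs, abs_of_pos hη]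
    congr 2; field_simp
  simp_rw [h]
  have hpe : 0 < π / η := by positivity
  rw [← ofReal_integral_eq_lintegral_ofReal]
  · rw [integral_const_mul, GaussianFourier.integral_rexp_neg_mul_sq_norm hpe,
      div_div_cancel₀ pi_ne_zero, ← rpow_add hη]
    ring_nf; simp
  · apply Integrable.const_mul
    have := (integrable_gb (V := V) (b := ((1/η : ℝ) : ℂ)) (by simpa using hη)).norm
    simp_rw [norm_gb] at this
    convert this using 3
    rw [Complex.ofReal_re]; ring
  · exact Eventually.of_forall fun w => by positivity

lemma plancherel_reg {η : ℝ} (hη : 0 < η) {f : V → ℂ} (hf : Integrable f) (hfm : Measurable f) :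
    ∫⁻ y, ENNReal.ofReal (Real.exp (-(π * η) * ‖y‖ ^ 2) * ‖𝓕 f y‖ ^ 2) ≤ ∫⁻ x, ENNReal.ofReal (‖f x‖ ^ 2) := by
  have hb : 0 < (η : ℂ).re := by simpa using hη
  have hgint := integrable_gb_mul hb hf
  have hK : Measurable fun w : V => ENNReal.ofReal ‖Kb (η : ℂ) w‖ := by
    unfold Kb; fun_prop
  have e1 : ∫ y, (gb (η : ℂ) y * 𝓕 f y) * conj (𝓕 f y) = ∫ z, Sop (η : ℂ) f z * conj (f z) := pairing hgint hf
  have e2 : ∀ y : V, (gb (η : ℂ) y * 𝓕 f y) * conj (𝓕 f y) = ((Real.exp (-(π * η) * ‖y‖ ^ 2) * ‖𝓕 f y‖ ^ 2 : ℝ) : ℂ) := by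
    intro y
    rw [mul_assoc, Complex.mul_conj, Complex.normSq_eq_norm_sq, gb]
    push_cast; rfl
  have hint2 : Integrable fun y : V => Real.exp (-(π * η) * ‖y‖ ^ 2) * ‖𝓕 f y‖ ^ 2 := by
    have h3 : Integrable fun y : V => (gb (η : ℂ) y * 𝓕 f y) * conj (𝓕 f y) := by
      refine hgint.mul_bdd (c := ∫ x, ‖f x‖) ?_ ?_
      · exact (Complex.continuous_conj.comp (continuous_fourier' hf)).aestronglyMeasurable
      · exact Eventually.of_forall fun y => by rw [RCLike.norm_conj]; exact norm_fourier_le y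
    simp_rw [e2] at h3
    exact h3.re
  rw [← ofReal_integral_eq_lintegral_ofReal hint2 (Eventually.of_forall fun y => by positivity)]
  simp_rw [e2] at e1
  rw [integral_complex_ofReal] at e1
  have hle : (∫ y : V, Real.exp (-(π * η) * ‖y‖ ^ 2) * ‖𝓕 f y‖ ^ 2) ≤ ‖∫ z, Sop (η : ℂ) f z * conj (f z)‖ := by
    rw [← e1, Complex.norm_real]; exact le_abs_self _
  refine (ENNReal.ofReal_le_ofReal hle).trans ?_
  rw [ofReal_norm]
  refine (enorm_integral_le_lintegral_enorm _).trans ?_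
  have step : ∀ z, ‖Sop (η : ℂ) f z * conj (f z)‖ₑ ≤ 
      ∫⁻ x, ENNReal.ofReal (2⁻¹ * (‖f x‖ ^ 2)) * ENNReal.ofReal ‖Kb (η : ℂ) (z - x)‖ + ENNReal.ofReal (2⁻¹ * (‖f z‖ ^ 2)) * ENNReal.ofReal ‖Kb (η : ℂ) (z - x)‖ := by
    intro z
    rw [Sop_eq hb hf, ← integral_mul_const]
    refine (enorm_integral_le_lintegral_enorm _).trans ?_
    apply lintegral_mono
    intro x
    simp only
    rw [← ofReal_norm, norm_mul, norm_mul, RCLike.norm_conj, ← add_mul, ← ENNReal.ofReal_add (by positivity) (by positivity),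
      ← ENNReal.ofReal_mul (by positivity)]
    apply ENNReal.ofReal_le_ofReal
    nlinarith [mul_nonneg (norm_nonneg (Kb (η : ℂ) (z - x))) (sq_nonneg (‖f x‖ - ‖f z‖))]
  refine (lintegral_mono step).trans ?_
  have m1 : Measurable (Function.uncurry fun z x : V => ENNReal.ofReal (2⁻¹ * (‖f x‖ ^ 2)) * ENNReal.ofReal ‖Kb (η : ℂ) (z - x)‖) := by
    have : Measurable fun p : V × V => ENNReal.ofReal ‖Kb (η : ℂ) (p.1 - p.2)‖ := hK.comp (measurable_fst.sub measurable_snd)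
    simp only [Function.uncurry_def]; fun_prop
  have m2 : ∀ z, Measurable fun x : V => ENNReal.ofReal ‖Kb (η : ℂ) (z - x)‖ := fun z => hK.comp (measurable_const.sub measurable_id)
  have m3 : ∀ x, Measurable fun z : V => ENNReal.ofReal ‖Kb (η : ℂ) (z - x)‖ := fun z => hK.comp (measurable_id.sub measurable_const)
  have s1 : ∀ z, (∫⁻ x, ENNReal.ofReal (2⁻¹ * (‖f x‖ ^ 2)) * ENNReal.ofReal ‖Kb (η : ℂ) (z - x)‖ + ENNReal.ofReal (2⁻¹ * (‖f z‖ ^ 2)) * ENNReal.ofReal ‖Kb (η : ℂ) (z - x)‖)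
      = (∫⁻ x, ENNReal.ofReal (2⁻¹ * (‖f x‖ ^ 2)) * ENNReal.ofReal ‖Kb (η : ℂ) (z - x)‖) + ENNReal.ofReal (2⁻¹ * (‖f z‖ ^ 2)) := by
    intro z
    rw [lintegral_add_left m1.of_uncurry_left, lintegral_const_mul _ (m2 z),
      lintegral_sub_left_eq_self (fun w : V => ENNReal.ofReal ‖Kb (η : ℂ) w‖) z, lint_Kb hη, mul_one]
  simp_rw [s1]
  have m1' : Measurable fun z : V => ∫⁻ x : V, ENNReal.ofReal (2⁻¹ * (‖f x‖ ^ 2)) * ENNReal.ofReal ‖Kb (η : ℂ) (z - x)‖ :=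
    m1.lintegral_prod_right'
  rw [lintegral_add_left m1', lintegral_lintegral_swap m1.aemeasurable]
  have s2 : ∀ x, ∫⁻ z, ENNReal.ofReal (2⁻¹ * (‖f x‖ ^ 2)) * ENNReal.ofReal ‖Kb (η : ℂ) (z - x)‖ = ENNReal.ofReal (2⁻¹ * (‖f x‖ ^ 2)) := by
    intro x
    rw [lintegral_const_mul _ (m3 x),
      lintegral_sub_right_eq_self (fun w : V => ENNReal.ofReal ‖Kb (η : ℂ) w‖) x, lint_Kb hη, mul_one]
  simp_rw [s2]
  rw [← lintegral_add_left (by fun_prop)]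
  apply lintegral_mono
  intro x
  simp only
  rw [← ENNReal.ofReal_add (by positivity) (by positivity)]
  exact ENNReal.ofReal_le_ofReal (le_of_eq (by ring))

/-- Removing the Gaussian regularisation. -/
lemma lint_remove_gauss {F : V → ℝ} (hF : Measurable F) (hF0 : ∀ y, 0 ≤ F y) {A : ℝ≥0∞}
    (h : ∀ η : ℝ, 0 < η → ∫⁻ y, ENNReal.ofReal (Real.exp (-(π * η) * ‖y‖ ^ 2) * F y) ≤ A) :
    ∫⁻ y, ENNReal.ofReal (F y) ≤ A := by
  have hlim : ∀ y : V, Tendsto (fun k : ℕ => ENNReal.ofReal (Real.exp (-(π * (1 / ((k : ℝ) + 1))) * ‖y‖ ^ 2) * F y)) atTop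
      (𝓝 (ENNReal.ofReal (F y))) := by
    intro y
    apply ENNReal.tendsto_ofReal
    have h1 := tendsto_one_div_add_atTop_nhds_zero_nat (𝕜 := ℝ)
    have h2 : Tendsto (fun e : ℝ => Real.exp (-(π * e) * ‖y‖ ^ 2) * F y) (𝓝 0) (𝓝 (Real.exp (-(π * 0) * ‖y‖ ^ 2) * F y)) :=
      Continuous.tendsto (by fun_prop) 0
    simp only [mul_zero, neg_zero, zero_mul, Real.exp_zero, one_mul] at h2
    exact h2.comp h1
  calc ∫⁻ y, ENNReal.ofReal (F y) = ∫⁻ y, liminf (fun k : ℕ => ENNReal.ofReal (Real.exp (-(π * (1 / ((k : ℝ) + 1))) * ‖y‖ ^ 2) * F y)) atTop := by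
        congr 1; ext y; exact (hlim y).liminf_eq.symm
    _ ≤ liminf (fun k : ℕ => ∫⁻ y, ENNReal.ofReal (Real.exp (-(π * (1 / ((k : ℝ) + 1))) * ‖y‖ ^ 2) * F y)) atTop :=
        lintegral_liminf_le (fun k => by fun_prop)
    _ ≤ liminf (fun k : ℕ => A) atTop := liminf_le_liminf (Eventually.of_forall fun k => h _ (by positivity))
    _ = A := liminf_const _

lemma plancherel_le {f : V → ℂ} (hf : Integrable f) (hfm : Measurable f) :
    ∫⁻ y, ENNReal.ofReal (‖𝓕 f y‖ ^ 2) ≤ ∫⁻ x, ENNReal.ofReal (‖f x‖ ^ 2) :=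
  lint_remove_gauss (by have := (continuous_fourier' hf).measurable; fun_prop) (fun y => by positivity)
    (fun η hη => plancherel_reg hη hf hfm)

lemma plancherel_inv_le {f : V → ℂ} (hf : Integrable f) (hfm : Measurable f) :
    ∫⁻ y, ENNReal.ofReal (‖𝓕⁻ f y‖ ^ 2) ≤ ∫⁻ x, ENNReal.ofReal (‖f x‖ ^ 2) := by
  refine le_trans (le_of_eq ?_) (plancherel_le hf hfm)
  simp_rw [Real.fourierInv_eq_fourier_neg]
  exact lintegral_neg_eq_self (μ := volume) (fun y => ENNReal.ofReal (‖𝓕 f y‖ ^ 2))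

lemma Sop_L2 {b : ℂ} (hb : 0 < b.re) {f : V → ℂ} (hf : Integrable f) (hfm : Measurable f) :
    ∫⁻ y, ENNReal.ofReal (‖Sop b f y‖ ^ 2) ≤ ∫⁻ x, ENNReal.ofReal (‖f x‖ ^ 2) := by
  refine (plancherel_inv_le (integrable_gb_mul hb hf) ((continuous_gb b).mul (continuous_fourier' hf)).measurable).trans ?_
  refine le_trans ?_ (plancherel_le hf hfm)
  apply lintegral_mono
  intro y
  apply ENNReal.ofReal_le_ofReal
  gcongr
  rw [norm_mul]
  exact mul_le_of_le_one_left (norm_nonneg _) (norm_gb_le hb y)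

lemma Sop_add {b : ℂ} (hb : 0 < b.re) {f g : V → ℂ} (hf : Integrable f) (hg : Integrable g) (z : V) :
    Sop b (fun x => f x + g x) z = Sop b f z + Sop b g z := by
  have hk : ∀ {f : V → ℂ}, Integrable f → Integrable fun x => f x * Kb b (z - x) := by
    intro f hf
    refine hf.mul_bdd (c := ‖b‖ ^ (-(Module.finrank ℝ V : ℝ) / 2)) ?_ (Eventually.of_forall fun x => norm_Kb_le hb _)
    apply Continuous.aestronglyMeasurable
    unfold Kb; fun_prop
  rw [Sop_eq hb hf, Sop_eq hb hg, Sop_eq (f := fun x => f x + g x) hb (hf.add hg), ← integral_add (hk hf) (hk hg)]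
  simp only [add_mul]

end FourierPart


section BilinearPart
open scoped FourierTransform

variable {V : Type*} [NormedAddCommGroup V] [InnerProductSpace ℝ V] [FiniteDimensional ℝ V]
  [MeasurableSpace V] [BorelSpace V]

lemma Sop_Lr {r p : ℝ} (hr : 2 < r) (hp : p = r / (r - 1)) {b : ℂ} (hb : 0 < b.re) (hσ : b.im ≠ 0)
    {f : V → ℂ} (hf : Integrable f) (hfm : Measurable f) {X : ℝ} (hX : 0 < X)
    (hfX : ∫⁻ x, ENNReal.ofReal (‖f x‖ ^ p) = ENNReal.ofReal X) :
    ∫⁻ x, ENNReal.ofReal (‖Sop b f x‖ ^ r) ≤ ENNReal.ofReal ((4 * r * 2 ^ (r - 2) / (r - 2)) *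
      (|b.im| ^ (-(Module.finrank ℝ V : ℝ) / 2)) ^ (r - 2) * X ^ (r - 1)) := by
  have hσ' : 0 < |b.im| := abs_pos.2 hσ
  have hle : ‖b‖ ^ (-(Module.finrank ℝ V : ℝ) / 2) ≤ |b.im| ^ (-(Module.finrank ℝ V : ℝ) / 2) := by
    apply rpow_le_rpow_of_nonpos hσ' (Complex.abs_im_le_norm b)
    have : (0 : ℝ) ≤ Module.finrank ℝ V := by positivity
    linarith
  refine marcin volume hr hp (by positivity) hX hfm (continuous_Sop hb hf).measurable hfX ?_
  intro l hl
  have ms1 : MeasurableSet {x | l < ‖f x‖} := measurableSet_lt measurable_const hfm.norm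
  have ms2 : MeasurableSet {x | ‖f x‖ ≤ l} := measurableSet_le hfm.norm measurable_const
  have i1 := hf.indicator ms1
  have i2 := hf.indicator ms2
  refine ⟨Sop b (Set.indicator {x | l < ‖f x‖} f), Sop b (Set.indicator {x | ‖f x‖ ≤ l} f),
    (continuous_Sop hb i2).measurable, ?_, ?_, ?_⟩
  · intro x
    rw [← Sop_add hb i1 i2]
    congr 1
    ext y
    by_cases h : l < ‖f y‖
    · rw [Set.indicator_of_mem (s := {x | l < ‖f x‖}) h, Set.indicator_of_notMem (s := {x | ‖f x‖ ≤ l}) (by simpa using h), add_zero]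
    · rw [Set.indicator_of_notMem (s := {x | l < ‖f x‖}) h, Set.indicator_of_mem (s := {x | ‖f x‖ ≤ l}) (by simpa using h), zero_add]
  · intro x
    have h1 := (norm_Sop_le hb i1 x).trans (mul_le_mul_of_nonneg_right hle (integral_nonneg fun _ => norm_nonneg _))
    refine (ENNReal.ofReal_le_ofReal h1).trans ?_
    rw [ENNReal.ofReal_mul (by positivity), ofReal_integral_eq_lintegral_ofReal i1.norm (Eventually.of_forall fun _ => norm_nonneg _),
      ← lintegral_indicator ms1]
    refine le_of_eq ?_
    congr 2
    ext y
    by_cases h : l < ‖f y‖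
    · rw [Set.indicator_of_mem (s := {x | l < ‖f x‖}) h, Set.indicator_of_mem (s := {x | l < ‖f x‖}) h]
    · rw [Set.indicator_of_notMem (s := {x | l < ‖f x‖}) h, Set.indicator_of_notMem (s := {x | l < ‖f x‖}) h]; simp
  · refine (Sop_L2 hb i2 (hfm.indicator ms2)).trans (le_of_eq ?_)
    rw [← lintegral_indicator ms2]
    congr 1
    ext y
    by_cases h : ‖f y‖ ≤ l
    · rw [Set.indicator_of_mem (s := {x | ‖f x‖ ≤ l}) h, Set.indicator_of_mem (s := {x | ‖f x‖ ≤ l}) h]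
    · rw [Set.indicator_of_notMem (s := {x | ‖f x‖ ≤ l}) h, Set.indicator_of_notMem (s := {x | ‖f x‖ ≤ l}) h]; simp

lemma ae_zero_of_lint {p : ℝ} (hp : 0 < p) {f : V → ℂ} (hfm : Measurable f)
    (h : ∫⁻ x, ENNReal.ofReal (‖f x‖ ^ p) = 0) : f =ᵐ[volume] 0 := by
  rw [lintegral_eq_zero_iff (by fun_prop)] at h
  filter_upwards [h] with x hx
  simp only [Pi.zero_apply, ENNReal.ofReal_eq_zero] at hx
  by_contra hne
  have : 0 < ‖f x‖ := norm_pos_iff.2 hne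
  have := rpow_pos_of_pos this p
  linarith

lemma bilin {r p : ℝ} (hr : 2 < r) (hp : p = r / (r - 1)) {b : ℂ} (hb : 0 < b.re) (hσ : b.im ≠ 0)
    {f h : V → ℂ} (hf : Integrable f) (hfm : Measurable f) (hh : Integrable h) (hhm : Measurable h)
    {X Y : ℝ} (hX : 0 ≤ X) (hY : 0 ≤ Y)
    (hfX : ∫⁻ x, ENNReal.ofReal (‖f x‖ ^ p) = ENNReal.ofReal X)
    (hhY : ∫⁻ x, ENNReal.ofReal (‖h x‖ ^ p) = ENNReal.ofReal Y) :
    ‖∫ y, gb b y * 𝓕 f y * conj (𝓕 h y)‖ ≤ (4 * r * 2 ^ (r - 2) / (r - 2)) ^ (1 / r) *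
      |b.im| ^ (-((Module.finrank ℝ V : ℝ) * (1 / 2 - 1 / r))) * X ^ (1 / p) * Y ^ (1 / p) := by
  have hr1 : 0 < r - 1 := by linarith
  have hr2 : 0 < r - 2 := by linarith
  have hr0 : 0 < r := by linarith
  have hp0 : 0 < p := by rw [hp]; positivity
  have hσ' : 0 < |b.im| := abs_pos.2 hσ
  rw [pairing (integrable_gb_mul hb hf) hh]
  change ‖∫ z, Sop b f z * conj (h z)‖ ≤ _
  rcases hX.eq_or_lt with h0 | hX
  · have : f =ᵐ[volume] 0 := ae_zero_of_lint hp0 hfm (by rw [hfX, ← h0, ENNReal.ofReal_zero])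
    have h2 : ∀ z, Sop b f z = 0 := by
      intro z
      rw [Sop_eq hb hf]
      apply integral_eq_zero_of_ae
      filter_upwards [this] with x hx
      simp [hx]
    simp only [h2, zero_mul, integral_zero, norm_zero]
    positivity
  · have hc : r.HolderConjugate p := by
      rw [Real.holderConjugate_iff]
      refine ⟨by linarith, ?_⟩
      rw [hp]; field_simp; ring
    have hS := Sop_Lr hr hp hb hσ hf hfm hX hfX
    have h1 : ENNReal.ofReal ‖∫ z, Sop b f z * conj (h z)‖ ≤ ENNReal.ofReal ((4 * r * 2 ^ (r - 2) / (r - 2)) ^ (1 / r) *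
      |b.im| ^ (-((Module.finrank ℝ V : ℝ) * (1 / 2 - 1 / r))) * X ^ (1 / p) * Y ^ (1 / p)) := by
      rw [ofReal_norm]
      refine (enorm_integral_le_lintegral_enorm _).trans ?_
      have e1 : ∀ z, ‖Sop b f z * conj (h z)‖ₑ = ENNReal.ofReal ‖Sop b f z‖ * ENNReal.ofReal ‖h z‖ := by
        intro z
        rw [← ofReal_norm, norm_mul, RCLike.norm_conj, ENNReal.ofReal_mul (norm_nonneg _)]
      simp_rw [e1]
      have mS := (continuous_Sop hb hf).measurable
      refine (ENNReal.lintegral_mul_le_Lp_mul_Lq volume hc (by fun_prop) (by fun_prop)).trans ?_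
      simp_rw [ENNReal.ofReal_rpow_of_nonneg (norm_nonneg _) hr0.le, ENNReal.ofReal_rpow_of_nonneg (norm_nonneg _) hp0.le]
      rw [hhY, ENNReal.ofReal_rpow_of_nonneg hY (by positivity), ENNReal.ofReal_mul (by positivity)]
      gcongr
      refine (ENNReal.rpow_le_rpow hS (by positivity)).trans (le_of_eq ?_)
      rw [ENNReal.ofReal_rpow_of_nonneg (by positivity) (by positivity), mul_rpow (by positivity) (by positivity),
        mul_rpow (by positivity) (by positivity), ← rpow_mul (by positivity), ← rpow_mul (by positivity), ← rpow_mul (by positivity)]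
      have ea : -(Module.finrank ℝ V : ℝ) / 2 * ((r - 2) * (1 / r)) = -((Module.finrank ℝ V : ℝ) * (1 / 2 - 1 / r)) := by
        field_simp
      have eb : (r - 1) * (1 / r) = 1 / p := by rw [hp]; field_simp
      rw [ea, eb]
    rwa [ENNReal.ofReal_le_ofReal_iff (by positivity)] at h1

end BilinearPart

section DualPart
open scoped FourierTransform

variable {V : Type*} [NormedAddCommGroup V] [InnerProductSpace ℝ V] [FiniteDimensional ℝ V]
  [MeasurableSpace V] [BorelSpace V]

/-- Bounded measurable compactly supported space-time functions. -/
structure NiceH (H : ℝ → V → ℂ) (m B : ℝ) : Prop where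
  meas : Measurable (Function.uncurry H)
  bd : ∀ s x, ‖H s x‖ ≤ B
  supp1 : ∀ s x, m < |s| → H s x = 0
  supp2 : ∀ s x, m < ‖x‖ → H s x = 0

/-- The space-time kernel integrand. -/
def kk (H : ℝ → V → ℂ) (s : ℝ) (y : V) : ℂ := Complex.exp (-(π * s * (‖y‖ : ℂ) ^ 2) * Complex.I) * 𝓕 (H s) y

/-- The dual operator. -/
def Wd (H : ℝ → V → ℂ) (y : V) : ℂ := ∫ s, kk H s y

variable {H : ℝ → V → ℂ} {m B : ℝ}

lemma NiceH.B0 (hH : NiceH H m B) : 0 ≤ B := (norm_nonneg _).trans (hH.bd 0 0)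

lemma NiceH.measS (hH : NiceH H m B) (s : ℝ) : Measurable (H s) := hH.meas.of_uncurry_left

lemma NiceH.int_of (hH : NiceH H m B) (s : ℝ) : Integrable (H s) := by
  rw [← integrableOn_iff_integrable_of_support_subset (s := Metric.closedBall (0 : V) m)]
  · exact Measure.integrableOn_of_bounded (measure_closedBall_lt_top.ne) (hH.measS s).aestronglyMeasurable
      (Eventually.of_forall fun x => hH.bd s x)
  · intro x hx
    rw [mem_closedBall_zero_iff]
    by_contra h
    exact hx (hH.supp2 s x (not_le.1 h))

lemma NiceH.measF (hH : NiceH H m B) : Measurable (fun z : ℝ × V => 𝓕 (H z.1) z.2) := by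
  have h : (fun z : ℝ × V => 𝓕 (H z.1) z.2) = fun z : ℝ × V =>
      ∫ v : V, Complex.exp (((-2 * π * inner ℝ v z.2 : ℝ) : ℂ) * Complex.I) • H z.1 v := by
    ext z; rw [Real.fourier_eq']
  rw [h]
  apply StronglyMeasurable.measurable
  apply StronglyMeasurable.integral_prod_right' (f := fun w : (ℝ × V) × V =>
    Complex.exp (((-2 * π * inner ℝ w.2 w.1.2 : ℝ) : ℂ) * Complex.I) • H w.1.1 w.2)
  apply Measurable.stronglyMeasurable
  have h1 : Measurable fun w : (ℝ × V) × V => H w.1.1 w.2 :=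
    hH.meas.comp ((measurable_fst.fst).prodMk measurable_snd)
  have h2 : Continuous fun w : (ℝ × V) × V => Complex.exp (((-2 * π * inner ℝ w.2 w.1.2 : ℝ) : ℂ) * Complex.I) := by
    fun_prop
  exact h2.measurable.smul h1

lemma NiceH.normF (hH : NiceH H m B) (s : ℝ) (y : V) :
    ‖𝓕 (H s) y‖ ≤ Set.indicator (Set.Icc (-m) m) (fun _ => B * (volume (Metric.closedBall (0 : V) m)).toReal) s := by
  by_cases hs : s ∈ Set.Icc (-m) m
  · rw [Set.indicator_of_mem hs]
    refine (norm_fourier_le y).trans ?_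
    have : ∫ x, ‖H s x‖ = ∫ x in Metric.closedBall (0 : V) m, ‖H s x‖ := by
      rw [setIntegral_eq_integral_of_forall_compl_eq_zero]
      intro x hx
      rw [mem_closedBall_zero_iff, not_le] at hx
      rw [hH.supp2 s x hx, norm_zero]
    rw [this]
    have h2 := norm_setIntegral_le_of_norm_le_const (μ := volume) (s := Metric.closedBall (0 : V) m)
      (f := fun x => ‖H s x‖) (C := B) measure_closedBall_lt_top (fun x _ => by rw [norm_norm]; exact hH.bd s x)
    exact (le_abs_self _).trans h2
  · rw [Set.indicator_of_notMem hs]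
    have : H s = 0 := by
      ext x
      refine hH.supp1 s x ?_
      by_contra h
      exact hs (abs_le.1 (not_lt.1 h))
    rw [this]
    simp [Real.fourier_eq']

lemma norm_kk (s : ℝ) (y : V) : ‖kk H s y‖ = ‖𝓕 (H s) y‖ := by
  rw [kk, norm_mul]
  have : -(π * s * (‖y‖ : ℂ) ^ 2) * Complex.I = ((-(π * s * ‖y‖ ^ 2) : ℝ) : ℂ) * Complex.I := by push_cast; rfl
  rw [this, Complex.norm_exp_ofReal_mul_I, one_mul]

lemma NiceH.meas_kk (hH : NiceH H m B) : Measurable (fun z : ℝ × V => kk H z.1 z.2) := by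
  unfold kk
  have := hH.measF
  have h2 : Continuous fun z : ℝ × V => Complex.exp (-(π * z.1 * (‖z.2‖ : ℂ) ^ 2) * Complex.I) := by fun_prop
  exact h2.measurable.mul this

lemma NiceH.meas_Wd (hH : NiceH H m B) : Measurable (Wd H) := by
  apply StronglyMeasurable.measurable
  apply StronglyMeasurable.integral_prod_right' (f := fun z : V × ℝ => kk H z.2 z.1)
  exact (hH.meas_kk.comp measurable_swap).stronglyMeasurable

lemma kk_mul (η : ℝ) (s s' : ℝ) (y : V) :
    gb (η : ℂ) y * (kk H s y * conj (kk H s' y)) =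
      gb ((η : ℂ) + (s - s') * Complex.I) y * 𝓕 (H s) y * conj (𝓕 (H s') y) := by
  unfold kk gb
  rw [map_mul, ← Complex.exp_conj]
  have : Complex.exp (-(π * ((η : ℂ) + (s - s') * Complex.I)) * (‖y‖ : ℂ) ^ 2) =
    Complex.exp (-(π * (η : ℂ)) * (‖y‖ : ℂ) ^ 2) * Complex.exp (-(π * s * (‖y‖ : ℂ) ^ 2) * Complex.I)
      * Complex.exp (conj (-(π * s' * (‖y‖ : ℂ) ^ 2) * Complex.I)) := by
    rw [← Complex.exp_add, ← Complex.exp_add]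
    congr 1
    simp only [map_mul, map_neg, map_pow, Complex.conj_ofReal, Complex.conj_I]
    ring
  rw [this]
  ring

lemma meas_Phi_aux {k : ℝ → V → ℂ} {g : V → ℂ} (hk : Measurable (fun z : ℝ × V => k z.1 z.2)) (hg : Measurable g) :
    Measurable (fun w : V × (ℝ × ℝ) => g w.1 * (k w.2.1 w.1 * conj (k w.2.2 w.1))) := by
  have c1 : Measurable (fun w : V × (ℝ × ℝ) => g w.1) := hg.comp measurable_fst
  have c2 : Measurable (fun w : V × (ℝ × ℝ) => k w.2.1 w.1) := by
    have e : Measurable (fun w : V × (ℝ × ℝ) => (w.2.1, w.1)) := by fun_prop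
    exact hk.comp e
  have c3 : Measurable (fun w : V × (ℝ × ℝ) => k w.2.2 w.1) := by
    have e : Measurable (fun w : V × (ℝ × ℝ) => (w.2.2, w.1)) := by fun_prop
    exact hk.comp e
  have c4 : Measurable (fun w : V × (ℝ × ℝ) => conj (k w.2.2 w.1)) := Complex.continuous_conj.measurable.comp c3
  exact c1.mul (c2.mul c4)

lemma NiceH.meas_Phi (hH : NiceH H m B) (η : ℝ) :
    Measurable (fun w : V × (ℝ × ℝ) => gb (η : ℂ) w.1 * (kk H w.2.1 w.1 * conj (kk H w.2.2 w.1))) :=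
  meas_Phi_aux (k := kk H) (g := gb (η : ℂ)) hH.meas_kk (continuous_gb (η : ℂ)).measurable

lemma dual_reg {r p δ pt : ℝ} (hr : 2 < r) (hp : p = r / (r - 1))
    (hδ : δ = (Module.finrank ℝ V : ℝ) * (1 / 2 - 1 / r)) (hδ0 : 0 < δ) (hδ1 : δ < 1) (hpt : pt = 2 / (2 - δ)) :
    ∃ C : ℝ, 0 < C ∧ ∀ (H : ℝ → V → ℂ) (m B X : ℝ), NiceH H m B → 0 < X →
      ∫⁻ s, ENNReal.ofReal (((∫ x, ‖H s x‖ ^ p) ^ (1 / p)) ^ pt) = ENNReal.ofReal X →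
      ∀ η : ℝ, 0 < η → ∫⁻ y, ENNReal.ofReal (Real.exp (-(π * η) * ‖y‖ ^ 2) * ‖Wd H y‖ ^ 2) ≤ ENNReal.ofReal (C * X ^ (2 - δ)) := by
  obtain ⟨C, hC, hls⟩ := hls hδ0 hδ1 hpt
  have hr1 : 0 < r - 1 := by linarith
  have hr2 : 0 < r - 2 := by linarith
  have hp0 : 0 < p := by rw [hp]; positivity
  set D : ℝ := (4 * r * 2 ^ (r - 2) / (r - 2)) ^ (1 / r) with hD
  have hD0 : 0 < D := by positivity
  refine ⟨D * C, by positivity, ?_⟩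
  intro H m B X hH hX hHX η hη
  set f : ℝ → ℝ := fun s => (∫ x, ‖H s x‖ ^ p) ^ (1 / p) with hf
  have hI0 : ∀ s, 0 ≤ ∫ x, ‖H s x‖ ^ p := fun s => integral_nonneg fun x => by positivity
  have hf0 : ∀ s, 0 ≤ f s := fun s => rpow_nonneg (hI0 s) _
  have hfm : Measurable f := by
    have : Measurable fun s => ∫ x, ‖H s x‖ ^ p := by
      apply StronglyMeasurable.measurable
      apply StronglyMeasurable.integral_prod_right' (f := fun z : ℝ × V => ‖H z.1 z.2‖ ^ p)
      exact (hH.meas.norm.pow_const p).stronglyMeasurable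
    exact this.pow_const _
  have hls1 := hls f hfm hf0 X hX hHX
  have hpi : ∀ s, Integrable fun x => ‖H s x‖ ^ p := by
    intro s
    rw [← integrableOn_iff_integrable_of_support_subset (s := Metric.closedBall (0 : V) m)]
    · refine Measure.integrableOn_of_bounded (M := B ^ p) (measure_closedBall_lt_top.ne)
        ((hH.measS s).norm.pow_const p).aestronglyMeasurable
        (Eventually.of_forall fun x => ?_)
      rw [norm_of_nonneg (by positivity)]
      exact rpow_le_rpow (norm_nonneg _) (hH.bd s x) hp0.le
    · intro x hx
      rw [mem_closedBall_zero_iff]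
      by_contra h
      apply hx
      simp only [hH.supp2 s x (not_le.1 h), norm_zero]
      exact zero_rpow hp0.ne'
  have hbil : ∀ s s' : ℝ, s ≠ s' → ‖∫ y, gb (η : ℂ) y * (kk H s y * conj (kk H s' y))‖ ≤
      D * (f s * f s' * |s - s'| ^ (-δ)) := by
    intro s s' hss
    simp_rw [kk_mul]
    have := bilin hr hp (b := (η : ℂ) + (s - s') * Complex.I) (by simpa using hη)
      (by simpa using sub_ne_zero.2 hss) (hH.int_of s) (hH.measS s) (hH.int_of s') (hH.measS s')
      (hI0 s) (hI0 s') (ofReal_integral_eq_lintegral_ofReal (hpi s) (Eventually.of_forall fun x => by positivity)).symm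
      (ofReal_integral_eq_lintegral_ofReal (hpi s') (Eventually.of_forall fun x => by positivity)).symm
    refine this.trans (le_of_eq ?_)
    simp only [Complex.add_im, Complex.ofReal_im, Complex.mul_im, Complex.sub_re, Complex.ofReal_re, Complex.I_im, Complex.I_re, Complex.sub_im, mul_one, mul_zero, add_zero, zero_add, sub_zero]
    rw [← hδ]
    simp only [hf]
    ring
  -- Fubini
  set A : ℝ := B * (volume (Metric.closedBall (0 : V) m)).toReal with hA
  set χ : ℝ → ℝ := Set.indicator (Set.Icc (-m) m) (fun _ => A) with hχ
  have hχi : Integrable χ := by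
    rw [hχ, integrable_indicator_iff measurableSet_Icc]
    exact integrableOn_const (by simp)
  have hΦm : Measurable (fun w : V × (ℝ × ℝ) => gb (η : ℂ) w.1 * (kk H w.2.1 w.1 * conj (kk H w.2.2 w.1))) := by
    exact hH.meas_Phi η
  have hb : 0 < (η : ℂ).re := by simpa using hη
  have hΦi : Integrable (Function.uncurry fun (y : V) (z : ℝ × ℝ) => gb (η : ℂ) y * (kk H z.1 y * conj (kk H z.2 y)))
      ((volume : Measure V).prod (volume : Measure (ℝ × ℝ))) := by
    have hg := (integrable_gb (V := V) hb).norm.mul_prod (hχi.mul_prod hχi)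
    refine hg.mono' hΦm.aestronglyMeasurable (Eventually.of_forall ?_)
    rintro ⟨y, s, s'⟩
    simp only [Function.uncurry_apply_pair]
    rw [norm_mul, norm_mul, RCLike.norm_conj, norm_kk, norm_kk]
    have a1 := hH.normF s y
    have a2 := hH.normF s' y
    gcongr
    exact (norm_nonneg _).trans a1
  have e1 : ∀ y : V, ((Real.exp (-(π * η) * ‖y‖ ^ 2) * ‖Wd H y‖ ^ 2 : ℝ) : ℂ) = ∫ z : ℝ × ℝ, gb (η : ℂ) y * (kk H z.1 y * conj (kk H z.2 y)) := by
    intro y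
    rw [integral_const_mul, Measure.volume_eq_prod, integral_prod_mul (fun s => kk H s y) (fun s => conj (kk H s y)), integral_conj]
    change _ = _ * (Wd H y * conj (Wd H y))
    rw [Complex.mul_conj, Complex.normSq_eq_norm_sq, gb]
    push_cast; rfl
  have hRi : Integrable fun y : V => Real.exp (-(π * η) * ‖y‖ ^ 2) * ‖Wd H y‖ ^ 2 := by
    have := hΦi.integral_prod_left
    simp only [Function.uncurry_apply_pair, ← e1] at this
    exact this.re
  rw [← ofReal_integral_eq_lintegral_ofReal hRi (Eventually.of_forall fun y => by positivity)]
  have e2 : ((∫ y : V, Real.exp (-(π * η) * ‖y‖ ^ 2) * ‖Wd H y‖ ^ 2 : ℝ) : ℂ) = ∫ z : ℝ × ℝ, ∫ y : V, gb (η : ℂ) y * (kk H z.1 y * conj (kk H z.2 y)) := by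
    rw [← integral_complex_ofReal]
    simp_rw [e1]
    exact integral_integral_swap hΦi
  have hle : (∫ y : V, Real.exp (-(π * η) * ‖y‖ ^ 2) * ‖Wd H y‖ ^ 2) ≤ ‖∫ z : ℝ × ℝ, ∫ y : V, gb (η : ℂ) y * (kk H z.1 y * conj (kk H z.2 y))‖ := by
    rw [← e2, Complex.norm_real]; exact le_abs_self _
  refine (ENNReal.ofReal_le_ofReal hle).trans ?_
  rw [ofReal_norm]
  refine (enorm_integral_le_lintegral_enorm _).trans ?_
  have hm2 : Measurable fun z : ℝ × ℝ => ‖∫ y : V, gb (η : ℂ) y * (kk H z.1 y * conj (kk H z.2 y))‖ₑ := by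
    apply Measurable.enorm
    apply StronglyMeasurable.measurable
    apply StronglyMeasurable.integral_prod_right' (f := fun w : (ℝ × ℝ) × V => gb (η : ℂ) w.2 * (kk H w.1.1 w.2 * conj (kk H w.1.2 w.2)))
    exact (hΦm.comp measurable_swap).stronglyMeasurable
  rw [Measure.volume_eq_prod, lintegral_prod _ hm2.aemeasurable]
  calc _ ≤ ∫⁻ s, ∫⁻ s', ENNReal.ofReal D * (ENNReal.ofReal (f s) * ENNReal.ofReal (f s') * ENNReal.ofReal (|s-s'|^(-δ))) := by
        apply lintegral_mono
        intro s
        apply lintegral_mono_ae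
        filter_upwards [Measure.ae_ne volume s] with s' hs'
        rw [← ofReal_norm, ← ENNReal.ofReal_mul (hf0 s), ← ENNReal.ofReal_mul (mul_nonneg (hf0 s) (hf0 s')), ← ENNReal.ofReal_mul hD0.le]
        exact ENNReal.ofReal_le_ofReal (hbil s s' hs'.symm)
    _ = ENNReal.ofReal D * ∫⁻ s, ∫⁻ s', (ENNReal.ofReal (f s) * ENNReal.ofReal (f s') * ENNReal.ofReal (|s-s'|^(-δ))) := by
        simp_rw [lintegral_const_mul' (ENNReal.ofReal D) _ ENNReal.ofReal_ne_top]
    _ ≤ ENNReal.ofReal D * ENNReal.ofReal (C * X ^ (2 - δ)) := by gcongr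
    _ = _ := by rw [← ENNReal.ofReal_mul hD0.le, mul_assoc]

lemma dual_bound {r p δ pt : ℝ} (hr : 2 < r) (hp : p = r / (r - 1))
    (hδ : δ = (Module.finrank ℝ V : ℝ) * (1 / 2 - 1 / r)) (hδ0 : 0 < δ) (hδ1 : δ < 1) (hpt : pt = 2 / (2 - δ)) :
    ∃ C : ℝ, 0 < C ∧ ∀ (H : ℝ → V → ℂ) (m B X : ℝ), NiceH H m B → 0 < X →
      ∫⁻ s, ENNReal.ofReal (((∫ x, ‖H s x‖ ^ p) ^ (1 / p)) ^ pt) = ENNReal.ofReal X →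
      ∫⁻ y, ENNReal.ofReal (‖Wd H y‖ ^ 2) ≤ ENNReal.ofReal (C * X ^ (2 - δ)) := by
  obtain ⟨C, hC, h⟩ := dual_reg (V := V) hr hp hδ hδ0 hδ1 hpt
  refine ⟨C, hC, fun H m B X hH hX hHX => ?_⟩
  refine lint_remove_gauss (by have := hH.meas_Wd; fun_prop) (fun y => by positivity) (h H m B X hH hX hHX)

end DualPart

section PrimalPart
open scoped FourierTransform

variable {V : Type*} [NormedAddCommGroup V] [InnerProductSpace ℝ V] [FiniteDimensional ℝ V]
  [MeasurableSpace V] [BorelSpace V]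

/-- The phase-modulated datum. -/
def modph (φ : V → ℂ) (s : ℝ) (y : V) : ℂ := Complex.exp ((π * s * (‖y‖ : ℂ) ^ 2) * Complex.I) * φ y

/-- The free evolution. -/
def Gs (φ : V → ℂ) (s : ℝ) (w : V) : ℂ := 𝓕⁻ (modph φ s) w

lemma norm_modph (φ : V → ℂ) (s : ℝ) (y : V) : ‖modph φ s y‖ = ‖φ y‖ := by
  rw [modph, norm_mul]
  have : (π * s * (‖y‖ : ℂ) ^ 2) * Complex.I = (((π * s * ‖y‖ ^ 2) : ℝ) : ℂ) * Complex.I := by push_cast; rfl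
  rw [this, Complex.norm_exp_ofReal_mul_I, one_mul]

lemma meas_modph {φ : V → ℂ} (hm : Measurable φ) : Measurable (fun z : ℝ × V => modph φ z.1 z.2) := by
  have h2 : Continuous fun z : ℝ × V => Complex.exp ((π * z.1 * (‖z.2‖ : ℂ) ^ 2) * Complex.I) := by fun_prop
  have h3 : Measurable fun z : ℝ × V => φ z.2 := hm.comp measurable_snd
  exact h2.measurable.mul h3

lemma meas_modph' {φ : V → ℂ} (hm : Measurable φ) (s : ℝ) : Measurable (modph φ s) :=
  (meas_modph hm).of_uncurry_left (f := modph φ)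

lemma int_modph {φ : V → ℂ} (hm : Measurable φ) (hi : Integrable φ) (s : ℝ) : Integrable (modph φ s) :=
  hi.norm.mono' (meas_modph' hm s).aestronglyMeasurable (Eventually.of_forall fun y => (norm_modph φ s y).le)

lemma norm_Gs_le (φ : V → ℂ) (s : ℝ) (w : V) : ‖Gs φ s w‖ ≤ ∫ y, ‖φ y‖ := by
  refine (norm_fourierInv_le w).trans (le_of_eq ?_)
  simp_rw [norm_modph]

lemma meas_Gs {φ : V → ℂ} (hm : Measurable φ) : Measurable (fun z : ℝ × V => Gs φ z.1 z.2) := by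
  have h : (fun z : ℝ × V => Gs φ z.1 z.2) = fun z : ℝ × V =>
      ∫ v : V, Complex.exp (((2 * π * inner ℝ v z.2 : ℝ) : ℂ) * Complex.I) • modph φ z.1 v := by
    ext z; rw [Gs, Real.fourierInv_eq']
  rw [h]
  apply StronglyMeasurable.measurable
  apply StronglyMeasurable.integral_prod_right' (f := fun w : (ℝ × V) × V =>
    Complex.exp (((2 * π * inner ℝ w.2 w.1.2 : ℝ) : ℂ) * Complex.I) • modph φ w.1.1 w.2)
  apply Measurable.stronglyMeasurable
  have hk := meas_modph hm
  have h1 : Measurable fun w : (ℝ × V) × V => modph φ w.1.1 w.2 := by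
    generalize modph φ = k at hk
    have e : Measurable (fun w : (ℝ × V) × V => (w.1.1, w.2)) := by fun_prop
    exact hk.comp e
  have h2 : Continuous fun w : (ℝ × V) × V => Complex.exp (((2 * π * inner ℝ w.2 w.1.2 : ℝ) : ℂ) * Complex.I) := by
    fun_prop
  exact h2.measurable.smul h1

lemma dual_pair {φ : V → ℂ} (hm : Measurable φ) (hi : Integrable φ) {H : ℝ → V → ℂ} {m B : ℝ} (hH : NiceH H m B) :
    ∫ s, ∫ w, Gs φ s w * conj (H s w) = ∫ y, φ y * conj (Wd H y) := by
  have h1 : ∀ s, ∫ w, Gs φ s w * conj (H s w) = ∫ y, φ y * conj (kk H s y) := by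
    intro s
    rw [show (∫ w, Gs φ s w * conj (H s w)) = ∫ y, modph φ s y * conj (𝓕 (H s) y) from
      (pairing (int_modph hm hi s) (hH.int_of s)).symm]
    congr 1
    ext y
    unfold modph kk
    rw [map_mul, ← Complex.exp_conj]
    simp only [map_mul, map_neg, map_pow, Complex.conj_ofReal, Complex.conj_I]
    ring_nf
  simp_rw [h1]
  rw [integral_integral_swap]
  · congr 1
    ext y
    rw [integral_const_mul, integral_conj]
    rfl
  · set A : ℝ := B * (volume (Metric.closedBall (0 : V) m)).toReal with hA
    set χ : ℝ → ℝ := Set.indicator (Set.Icc (-m) m) (fun _ => A) with hχ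
    have hχi : Integrable χ := by
      rw [hχ, integrable_indicator_iff measurableSet_Icc]
      exact integrableOn_const (by simp)
    have hg := hχi.mul_prod hi.norm
    refine hg.mono' ?_ (Eventually.of_forall ?_)
    · apply Measurable.aestronglyMeasurable
      have c1 : Measurable fun z : ℝ × V => φ z.2 := hm.comp measurable_snd
      have c2 := hH.meas_kk
      have c3 : Measurable fun z : ℝ × V => conj (kk H z.1 z.2) := Complex.continuous_conj.measurable.comp c2
      exact c1.mul c3
    · rintro ⟨s, y⟩
      simp only [Function.uncurry_apply_pair]
      rw [norm_mul, RCLike.norm_conj, norm_kk, mul_comm]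
      exact mul_le_mul_of_nonneg_right (hH.normF s y) (norm_nonneg _)

lemma cs_bound {φ W : V → ℂ} (hm : Measurable φ) (hW : Measurable W) {A1 A2 : ℝ} (h1 : 0 ≤ A1) (h2 : 0 ≤ A2)
    (hφ : ∫⁻ y, ENNReal.ofReal (‖φ y‖ ^ 2) ≤ ENNReal.ofReal A1) (hWb : ∫⁻ y, ENNReal.ofReal (‖W y‖ ^ 2) ≤ ENNReal.ofReal A2) :
    ‖∫ y, φ y * conj (W y)‖ ^ 2 ≤ A1 * A2 := by
  have h : ENNReal.ofReal ‖∫ y, φ y * conj (W y)‖ ≤ ENNReal.ofReal (A1 ^ (1 / 2 : ℝ) * A2 ^ (1 / 2 : ℝ)) := by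
    rw [ofReal_norm]
    refine (enorm_integral_le_lintegral_enorm _).trans ?_
    have e1 : ∀ z, ‖φ z * conj (W z)‖ₑ = ENNReal.ofReal ‖φ z‖ * ENNReal.ofReal ‖W z‖ := by
      intro z
      rw [← ofReal_norm, norm_mul, RCLike.norm_conj, ENNReal.ofReal_mul (norm_nonneg _)]
    simp_rw [e1]
    refine (ENNReal.lintegral_mul_le_Lp_mul_Lq volume Real.HolderConjugate.two_two (by fun_prop) (by fun_prop)).trans ?_
    simp_rw [ENNReal.ofReal_rpow_of_nonneg (norm_nonneg _) zero_le_two]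
    rw [ENNReal.ofReal_mul (by positivity), ← ENNReal.ofReal_rpow_of_nonneg h1 (by positivity),
      ← ENNReal.ofReal_rpow_of_nonneg h2 (by positivity)]
    simp only [rpow_two]
    gcongr
  rw [ENNReal.ofReal_le_ofReal_iff (by positivity)] at h
  calc ‖∫ y, φ y * conj (W y)‖ ^ 2 ≤ (A1 ^ (1 / 2 : ℝ) * A2 ^ (1 / 2 : ℝ)) ^ 2 := by gcongr
    _ = A1 * A2 := by
      rw [mul_pow, ← Real.sqrt_eq_rpow, ← Real.sqrt_eq_rpow, sq_sqrt h1, sq_sqrt h2]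

lemma rpow_between {x α β c : ℝ} (hα : 0 < α) (h1 : α ≤ x) (h2 : x ≤ β) : x ^ c ≤ α ^ c + β ^ c := by
  have hx : 0 < x := by linarith
  have hβ : 0 < β := by linarith
  have a1 : 0 ≤ α ^ c := by positivity
  have a2 : 0 ≤ β ^ c := by positivity
  rcases le_total 0 c with hc | hc
  · have := rpow_le_rpow hx.le h2 hc
    linarith
  · have := rpow_le_rpow_of_nonpos hα h1 hc
    linarith

/-- Truncated `L^r` mass. -/
def Pm (φ : V → ℂ) (r m s : ℝ) : ℝ := ∫ w in Metric.closedBall (0 : V) m, ‖Gs φ s w‖ ^ r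

lemma Pm_nonneg (φ : V → ℂ) (r m s : ℝ) : 0 ≤ Pm φ r m s := integral_nonneg fun w => by positivity

lemma int_Gs {φ : V → ℂ} (hm : Measurable φ) {r : ℝ} (hr : 0 < r) (m s : ℝ) :
    IntegrableOn (fun w => ‖Gs φ s w‖ ^ r) (Metric.closedBall (0 : V) m) := by
  have hmG : Measurable (Gs φ s) := (meas_Gs hm).of_uncurry_left (f := Gs φ)
  refine Measure.integrableOn_of_bounded (M := (∫ y, ‖φ y‖) ^ r) (measure_closedBall_lt_top.ne)
        (hmG.norm.pow_const r).aestronglyMeasurable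
        (Eventually.of_forall fun x => ?_)
  rw [norm_of_nonneg (by positivity)]
  exact rpow_le_rpow (norm_nonneg _) (norm_Gs_le φ s x) hr.le

lemma Pm_le {φ : V → ℂ} {r : ℝ} (hr : 0 < r) (m s : ℝ) :
    Pm φ r m s ≤ (∫ y, ‖φ y‖) ^ r * (volume (Metric.closedBall (0 : V) m)).toReal := by
  have h2 := norm_setIntegral_le_of_norm_le_const (μ := volume) (s := Metric.closedBall (0 : V) m)
      (f := fun w => ‖Gs φ s w‖ ^ r) (C := (∫ y, ‖φ y‖) ^ r) measure_closedBall_lt_top (fun x _ => by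
        rw [norm_of_nonneg (by positivity)]
        exact rpow_le_rpow (norm_nonneg _) (norm_Gs_le φ s x) hr.le)
  exact (le_abs_self _).trans h2

lemma meas_Pm {φ : V → ℂ} (hm : Measurable φ) (r m : ℝ) : Measurable (Pm φ r m) := by
  apply StronglyMeasurable.measurable
  apply StronglyMeasurable.integral_prod_right' (f := fun z : ℝ × V => ‖Gs φ z.1 z.2‖ ^ r)
  exact ((meas_Gs hm).norm.pow_const r).stronglyMeasurable

/-- Truncated set of times. -/
def Em (φ : V → ℂ) (r m : ℝ) : Set ℝ := {s | |s| ≤ m ∧ 1 / m ≤ Pm φ r m s}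

lemma meas_Em {φ : V → ℂ} (hm : Measurable φ) (r m : ℝ) : MeasurableSet (Em φ r m) :=
  (measurableSet_le measurable_id.abs measurable_const).inter (measurableSet_le measurable_const (meas_Pm hm r m))

/-- Time weight. -/
def αm (φ : V → ℂ) (r m c : ℝ) (s : ℝ) : ℝ := (Em φ r m).indicator (fun s => Pm φ r m s ^ c) s

/-- spatial dual function -/
def Qm (φ : V → ℂ) (r m : ℝ) (s : ℝ) (w : V) : ℂ :=
  (Metric.closedBall (0 : V) m).indicator (fun w => ((‖Gs φ s w‖ ^ (r - 2) : ℝ) : ℂ) * Gs φ s w) w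

/-- The extremising dual function. -/
def Hm (φ : V → ℂ) (r m c : ℝ) (s : ℝ) (w : V) : ℂ := (αm φ r m c s : ℂ) * Qm φ r m s w

lemma αm_nonneg (φ : V → ℂ) (r m c s : ℝ) : 0 ≤ αm φ r m c s :=
  Set.indicator_nonneg (fun s _ => rpow_nonneg (Pm_nonneg φ r m s) c) s

lemma norm_Qm (φ : V → ℂ) {r : ℝ} (hr : 2 < r) (m s : ℝ) (w : V) :
    ‖Qm φ r m s w‖ = (Metric.closedBall (0 : V) m).indicator (fun w => ‖Gs φ s w‖ ^ (r - 1)) w := by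
  rw [Qm, norm_indicator_eq_indicator_norm]
  congr 1
  ext w
  rw [norm_mul, Complex.norm_real, norm_of_nonneg (by positivity), ← rpow_add_one' (norm_nonneg _) (by linarith)]
  congr 1; ring

lemma nice_Hm {φ : V → ℂ} (hm : Measurable φ) {r m : ℝ} (hr : 2 < r) (hm0 : 0 < m) (c : ℝ) :
    ∃ B, NiceH (Hm φ r m c) m B := by
  have hr0 : 0 < r := by linarith
  set β := (∫ y, ‖φ y‖) ^ r * (volume (Metric.closedBall (0 : V) m)).toReal with hβ
  have hL : 0 ≤ ∫ y, ‖φ y‖ := integral_nonneg fun _ => norm_nonneg _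
  have hβ0 : 0 ≤ β := by positivity
  refine ⟨((1 / m) ^ c + β ^ c) * (∫ y, ‖φ y‖) ^ (r - 1), ?_, ?_, ?_, ?_⟩
  · have h1 : Measurable (αm φ r m c) := ((meas_Pm hm r m).pow_const c).indicator (meas_Em hm r m)
    have h2 : Measurable fun z : ℝ × V => ((αm φ r m c z.1 : ℝ) : ℂ) :=
      Complex.continuous_ofReal.measurable.comp (h1.comp measurable_fst)
    have h3 : Measurable fun z : ℝ × V => Qm φ r m z.1 z.2 := by
      have hG := meas_Gs hm
      have h4 : Measurable fun z : ℝ × V => ((‖Gs φ z.1 z.2‖ ^ (r - 2) : ℝ) : ℂ) * Gs φ z.1 z.2 :=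
        (Complex.continuous_ofReal.measurable.comp (hG.norm.pow_const (r - 2))).mul hG
      exact h4.indicator (measurable_snd (Metric.isClosed_closedBall.measurableSet : MeasurableSet (Metric.closedBall (0 : V) m)))
    exact h2.mul h3
  · intro s x
    rw [Hm, norm_mul, Complex.norm_real, norm_of_nonneg (αm_nonneg _ _ _ _ _), norm_Qm φ hr]
    have a1 : αm φ r m c s ≤ (1 / m) ^ c + β ^ c := by
      unfold αm
      apply Set.indicator_apply_le'
      · intro hs
        exact rpow_between (by positivity) hs.2 (Pm_le hr0 m s)
      · intro _; positivity
    have a2 : (Metric.closedBall (0 : V) m).indicator (fun w => ‖Gs φ s w‖ ^ (r - 1)) x ≤ (∫ y, ‖φ y‖) ^ (r - 1) := by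
      apply Set.indicator_apply_le'
      · intro _
        exact rpow_le_rpow (norm_nonneg _) (norm_Gs_le φ s x) (by linarith)
      · intro _; positivity
    have a3 : 0 ≤ (1 / m) ^ c + β ^ c := by positivity
    exact mul_le_mul a1 a2 (Set.indicator_nonneg (fun w _ => by positivity) x) a3
  · intro s x hs
    rw [Hm, αm, Set.indicator_of_notMem (fun h => absurd h.1 (not_le.2 hs))]
    simp
  · intro s x hx
    rw [Hm, Qm, Set.indicator_of_notMem (by rw [mem_closedBall_zero_iff]; exact not_le.2 hx)]
    simp

lemma int_Hm_p (φ : V → ℂ) {r p : ℝ} (m c s : ℝ) (hr : 2 < r) (hp : p = r / (r - 1)) :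
    ∫ w, ‖Hm φ r m c s w‖ ^ p = αm φ r m c s ^ p * Pm φ r m s := by
  have hr1 : 0 < r - 1 := by linarith
  have hp0 : 0 < p := by rw [hp]; positivity
  rw [Pm, ← integral_indicator Metric.isClosed_closedBall.measurableSet, ← integral_const_mul]
  congr 1
  ext w
  rw [Hm, norm_mul, Complex.norm_real, norm_of_nonneg (αm_nonneg _ _ _ _ _), norm_Qm φ hr,
    mul_rpow (αm_nonneg _ _ _ _ _) (Set.indicator_nonneg (fun w _ => by positivity) w)]
  congr 1
  by_cases h : w ∈ Metric.closedBall (0 : V) m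
  · rw [Set.indicator_of_mem h, Set.indicator_of_mem h, ← rpow_mul (norm_nonneg _)]
    congr 1
    rw [hp]; field_simp
  · rw [Set.indicator_of_notMem h, Set.indicator_of_notMem h, zero_rpow hp0.ne']

lemma int_G_Hm (φ : V → ℂ) {r : ℝ} (m c s : ℝ) (hr : 2 < r) :
    ∫ w, Gs φ s w * conj (Hm φ r m c s w) = ((αm φ r m c s * Pm φ r m s : ℝ) : ℂ) := by
  rw [Pm, ← integral_indicator Metric.isClosed_closedBall.measurableSet, ← integral_const_mul, ← integral_complex_ofReal]
  congr 1
  ext w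
  rw [Hm, Qm]
  by_cases h : w ∈ Metric.closedBall (0 : V) m
  · rw [Set.indicator_of_mem h, Set.indicator_of_mem h]
    simp only [map_mul, Complex.conj_ofReal]
    have : ‖Gs φ s w‖ ^ r = ‖Gs φ s w‖ ^ (r - 2) * ‖Gs φ s w‖ ^ 2 := by
      rw [← rpow_two, ← rpow_add' (norm_nonneg _) (by linarith)]
      congr 1; ring
    rw [this]
    have h2 : Gs φ s w * conj (Gs φ s w) = ((‖Gs φ s w‖ ^ 2 : ℝ) : ℂ) := by
      rw [Complex.mul_conj, Complex.normSq_eq_norm_sq]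
    push_cast at h2 ⊢
    rw [← h2]
    ring
  · rw [Set.indicator_of_notMem h, Set.indicator_of_notMem h]
    simp

end PrimalPart

section StrichartzPart
open scoped FourierTransform

variable {V : Type*} [NormedAddCommGroup V] [InnerProductSpace ℝ V] [FiniteDimensional ℝ V]
  [MeasurableSpace V] [BorelSpace V]

lemma strich_m {r δ q : ℝ} (hr : 2 < r)
    (hδ : δ = (Module.finrank ℝ V : ℝ) * (1 / 2 - 1 / r)) (hδ0 : 0 < δ) (hδ1 : δ < 1) (hq : q = 2 / δ) :
    ∃ C : ℝ, 0 < C ∧ ∀ (φ : V → ℂ), Measurable φ → Integrable φ → ∀ A1 : ℝ, 0 ≤ A1 →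
      ∫⁻ y, ENNReal.ofReal (‖φ y‖ ^ 2) ≤ ENNReal.ofReal A1 → ∀ m : ℝ, 0 < m →
      ∫⁻ s, (Em φ r m).indicator (fun s => ENNReal.ofReal (Pm φ r m s ^ (q / r))) s ≤
        ENNReal.ofReal ((C * A1) ^ (1 / δ)) := by
  obtain ⟨C, hC, hdual⟩ := dual_bound (V := V) hr rfl hδ hδ0 hδ1 rfl
  refine ⟨C, hC, ?_⟩
  intro φ hφ hφi A1 hA1 hφ2 m hm
  set c := (q - r) / r with hc
  set p := r / (r - 1) with hp
  set pt := 2 / (2 - δ) with hpt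
  have hr0 : 0 < r := by linarith
  have hr1 : 0 < r - 1 := by linarith
  have hp0 : 0 < p := by positivity
  have h2δ : 0 < 2 - δ := by linarith
  have hpt0 : 0 < pt := by positivity
  have hq0 : 0 < q := by rw [hq]; positivity
  obtain ⟨B, hH⟩ := nice_Hm (φ := φ) hφ hr hm c
  set g : ℝ → ℝ := fun s => αm φ r m c s * Pm φ r m s with hg
  have hg0 : ∀ s, 0 ≤ g s := fun s => mul_nonneg (αm_nonneg _ _ _ _ _) (Pm_nonneg _ _ _ _)
  have hPpos : ∀ s ∈ Em φ r m, 0 < Pm φ r m s := fun s hs => lt_of_lt_of_le (by positivity) hs.2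
  have hgE : ∀ s ∈ Em φ r m, g s = Pm φ r m s ^ (q / r) := by
    intro s hs
    simp only [hg]
    rw [αm, Set.indicator_of_mem hs, ← rpow_add_one (hPpos s hs).ne']
    congr 1
    rw [hc]; field_simp; ring
  have hgE' : ∀ s ∉ Em φ r m, g s = 0 := by
    intro s hs
    simp only [hg]
    rw [αm, Set.indicator_of_notMem hs, zero_mul]
  have e1 : ∀ s, (Em φ r m).indicator (fun s => ENNReal.ofReal (Pm φ r m s ^ (q / r))) s = ENNReal.ofReal (g s) := by
    intro s
    by_cases hs : s ∈ Em φ r m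
    · rw [Set.indicator_of_mem hs, hgE s hs]
    · rw [Set.indicator_of_notMem hs, hgE' s hs, ENNReal.ofReal_zero]
  have e2 : ∀ s, ((∫ x, ‖Hm φ r m c s x‖ ^ p) ^ (1 / p)) ^ pt = g s := by
    intro s
    rw [int_Hm_p φ m c s hr hp]
    by_cases hs : s ∈ Em φ r m
    · have hP := hPpos s hs
      rw [hgE s hs, αm, Set.indicator_of_mem hs, ← rpow_mul hP.le, ← rpow_add_one hP.ne', ← rpow_mul hP.le, ← rpow_mul hP.le]
      congr 1
      rw [hc, hp, hpt, hq]
      field_simp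
      ring
    · rw [hgE' s hs, αm, Set.indicator_of_notMem hs, zero_rpow hp0.ne', zero_mul, zero_rpow (by positivity), zero_rpow hpt0.ne']
  have hgm : Measurable g := 
    (((meas_Pm hφ r m).pow_const c).indicator (meas_Em hφ r m)).mul (meas_Pm hφ r m)
  have hgi : Integrable g := by
    rw [← integrableOn_iff_integrable_of_support_subset (s := Set.Icc (-m) m)]
    · set β := (∫ y, ‖φ y‖) ^ r * (volume (Metric.closedBall (0 : V) m)).toReal with hβ
      refine Measure.integrableOn_of_bounded (M := β ^ (q / r)) (by simp) hgm.aestronglyMeasurable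
        (Eventually.of_forall fun s => ?_)
      rw [norm_of_nonneg (hg0 s)]
      have hL : 0 ≤ ∫ y, ‖φ y‖ := integral_nonneg fun _ => norm_nonneg _
      by_cases hs : s ∈ Em φ r m
      · rw [hgE s hs]
        exact rpow_le_rpow (Pm_nonneg _ _ _ _) (Pm_le hr0 m s) (by positivity)
      · rw [hgE' s hs]; positivity
    · intro s hs
      by_contra h
      exact hs (hgE' s fun hE => h (abs_le.1 hE.1))
  simp_rw [e1]
  rw [← ofReal_integral_eq_lintegral_ofReal hgi (Eventually.of_forall hg0)]
  apply ENNReal.ofReal_le_ofReal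
  set X := ∫ s, g s with hX
  have hX0 : 0 ≤ X := integral_nonneg hg0
  rcases hX0.eq_or_lt with h0 | hXp
  · rw [← h0]; positivity
  have hd := hdual (Hm φ r m c) m B X hH hXp (by
    simp_rw [e2]
    exact (ofReal_integral_eq_lintegral_ofReal hgi (Eventually.of_forall hg0)).symm)
  have hpair := dual_pair hφ hφi hH
  simp_rw [int_G_Hm φ m c _ hr] at hpair
  rw [integral_complex_ofReal] at hpair
  have hcs := cs_bound hφ hH.meas_Wd hA1 (by positivity) hφ2 hd
  rw [← hpair, Complex.norm_real, norm_of_nonneg (hX0 : 0 ≤ ∫ s, αm φ r m c s * Pm φ r m s)] at hcs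
  change X ^ 2 ≤ _ at hcs
  have h3 : X ^ 2 = X ^ (2 - δ) * X ^ δ := by
    rw [← rpow_add hXp, sub_add_cancel, rpow_two]
  have h4 : X ^ δ ≤ C * A1 := by
    have h5 : 0 < X ^ (2 - δ) := by positivity
    rw [h3] at hcs
    refine le_of_mul_le_mul_left ?_ h5
    linarith
  calc X = (X ^ δ) ^ (1 / δ) := by rw [← rpow_mul hX0, mul_one_div_cancel hδ0.ne', rpow_one]
    _ ≤ _ := rpow_le_rpow (by positivity) h4 (by positivity)

lemma strich {r δ q : ℝ} (hr : 2 < r)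
    (hδ : δ = (Module.finrank ℝ V : ℝ) * (1 / 2 - 1 / r)) (hδ0 : 0 < δ) (hδ1 : δ < 1) (hq : q = 2 / δ) :
    ∃ C : ℝ, 0 < C ∧ ∀ (φ : V → ℂ), Measurable φ → Integrable φ → ∀ A1 : ℝ, 0 ≤ A1 →
      ∫⁻ y, ENNReal.ofReal (‖φ y‖ ^ 2) ≤ ENNReal.ofReal A1 → 
      ∫⁻ s, (∫⁻ w, ENNReal.ofReal (‖Gs φ s w‖ ^ r)) ^ (q / r) ≤ ENNReal.ofReal ((C * A1) ^ (1 / δ)) := by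
  obtain ⟨C, hC, h⟩ := strich_m (V := V) hr hδ hδ0 hδ1 hq
  refine ⟨C, hC, ?_⟩
  intro φ hφ hφi A1 hA1 hφ2
  have hr0 : 0 < r := by linarith
  have hq0 : 0 < q := by rw [hq]; positivity
  have hqr : 0 < q / r := by positivity
  set F : ℕ → ℝ → ℝ≥0∞ := fun k s => (Em φ r (k + 1)).indicator (fun s => ENNReal.ofReal (Pm φ r (k + 1) s ^ (q / r))) s with hF
  have hFm : ∀ k, Measurable (F k) := by
    intro k
    exact (((meas_Pm hφ r (k + 1)).pow_const _).ennreal_ofReal).indicator (meas_Em hφ r _)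
  have hPl : ∀ (k : ℕ) s, ENNReal.ofReal (Pm φ r (k + 1) s) = ∫⁻ w in Metric.closedBall (0 : V) (k + 1), ENNReal.ofReal (‖Gs φ s w‖ ^ r) := by
    intro k s
    exact ofReal_integral_eq_lintegral_ofReal (int_Gs hφ hr0 _ s) (Eventually.of_forall fun w => by positivity)
  have hlim : ∀ s, Tendsto (fun k : ℕ => ENNReal.ofReal (Pm φ r (k + 1) s)) atTop (𝓝 (∫⁻ w, ENNReal.ofReal (‖Gs φ s w‖ ^ r))) := by
    intro s
    simp_rw [hPl]
    have hU : (⋃ k : ℕ, Metric.closedBall (0 : V) (k + 1)) = Set.univ := by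
      rw [Set.eq_univ_iff_forall]
      intro w
      obtain ⟨k, hk⟩ := exists_nat_ge ‖w‖
      refine Set.mem_iUnion.2 ⟨k, ?_⟩
      rw [mem_closedBall_zero_iff]; linarith
    have hmono : Monotone fun k : ℕ => Metric.closedBall (0 : V) ((k : ℝ) + 1) := by
      intro i j hij
      apply Metric.closedBall_subset_closedBall
      have : (i : ℝ) ≤ j := by exact_mod_cast hij
      linarith
    have := setLIntegral_iUnion_of_directed (μ := volume) (fun w => ENNReal.ofReal (‖Gs φ s w‖ ^ r)) hmono.directed_le
    rw [hU, setLIntegral_univ] at this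
    rw [this]
    apply tendsto_atTop_iSup
    intro i j hij
    exact lintegral_mono_set (hmono hij)
  have key : ∀ s, (∫⁻ w, ENNReal.ofReal (‖Gs φ s w‖ ^ r)) ^ (q / r) ≤ liminf (fun k => F k s) atTop := by
    intro s
    by_cases h0 : (∫⁻ w, ENNReal.ofReal (‖Gs φ s w‖ ^ r)) = 0
    · rw [h0, ENNReal.zero_rpow_of_pos hqr]; exact zero_le
    have hev : ∀ᶠ k : ℕ in atTop, F k s = ENNReal.ofReal (Pm φ r (k + 1) s) ^ (q / r) := by
      obtain ⟨d, hd0, hd⟩ := exists_between (pos_iff_ne_zero.2 h0)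
      have e1 := (hlim s).eventually (lt_mem_nhds hd)
      have e2 : ∀ᶠ k : ℕ in atTop, ENNReal.ofReal (1 / ((k : ℝ) + 1)) < d := by
        have t := ENNReal.tendsto_ofReal (tendsto_one_div_add_atTop_nhds_zero_nat (𝕜 := ℝ))
        rw [ENNReal.ofReal_zero] at t
        exact t.eventually (gt_mem_nhds hd0)
      obtain ⟨K, hK⟩ := exists_nat_ge |s|
      filter_upwards [e1, e2, eventually_ge_atTop K] with k h1 h2 h3
      have hs : s ∈ Em φ r ((k : ℝ) + 1) := by
        constructor
        · have : (K : ℝ) ≤ k := by exact_mod_cast h3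
          linarith
        · exact ((ENNReal.ofReal_lt_ofReal_iff_of_nonneg (by positivity)).1 (h2.trans h1)).le
      simp only [hF]
      rw [Set.indicator_of_mem hs, ENNReal.ofReal_rpow_of_nonneg (Pm_nonneg _ _ _ _) hqr.le]
    have t2 : Tendsto (fun k => F k s) atTop (𝓝 ((∫⁻ w, ENNReal.ofReal (‖Gs φ s w‖ ^ r)) ^ (q / r))) := by
      refine Tendsto.congr' (hev.mono fun k hk => hk.symm) ?_
      exact (ENNReal.continuous_rpow_const.tendsto _).comp (hlim s)
    rw [t2.liminf_eq]
  calc _ ≤ ∫⁻ s, liminf (fun k => F k s) atTop := lintegral_mono key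
    _ ≤ liminf (fun k => ∫⁻ s, F k s) atTop := lintegral_liminf_le hFm
    _ ≤ liminf (fun _ : ℕ => ENNReal.ofReal ((C * A1) ^ (1 / δ))) atTop :=
        liminf_le_liminf (Eventually.of_forall fun k => h φ hφ hφi A1 hA1 hφ2 _ (by positivity))
    _ = _ := liminf_const _

end StrichartzPart

section TransferPart
open scoped FourierTransform

lemma lint_smul {n : ℕ} {c : ℝ} (hc : c ≠ 0) {g : Rn n → ℝ≥0∞} (hg : Measurable g) :
    ∫⁻ x, g (c • x) = ENNReal.ofReal |(c ^ n)⁻¹| * ∫⁻ x, g x := by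
  have h := Measure.map_addHaar_smul (volume : Measure (Rn n)) hc
  rw [← lintegral_map hg (measurable_const_smul c), h, lintegral_smul_measure, finrank_euclideanSpace_fin, smul_eq_mul]

lemma norm_Uprop {n : ℕ} {ε t : ℝ} (hε : 0 < ε) (ht : 0 < Real.sin t) (φ : Rn n → ℂ) (x : Rn n) :
    ‖Uprop n ε t φ x‖ = (2 * π * ε * Real.sin t) ^ (-(n : ℝ) / 2) *
      ‖Gs φ (Real.cos t / (2 * π * ε * Real.sin t)) ((-(2 * π * ε * Real.sin t)⁻¹) • x)‖ := by
  have hl : 0 < 2 * π * ε * Real.sin t := by positivity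
  have hgint : ∀ y : Rn n, Complex.exp ((Complex.I / ((ε * Real.sin t : ℝ) : ℂ)) *
      (((‖x‖ ^ 2 + ‖y‖ ^ 2) / 2 * Real.cos t - ∑ j, x j * y j : ℝ) : ℂ)) * φ y =
      Complex.exp (((Real.cos t * ‖x‖ ^ 2 / (2 * ε * Real.sin t) : ℝ) : ℂ) * Complex.I) *
      (Complex.exp (((2 * π * inner ℝ y ((-(2 * π * ε * Real.sin t)⁻¹) • x) : ℝ) : ℂ) * Complex.I) •
        modph φ (Real.cos t / (2 * π * ε * Real.sin t)) y) := by
    intro y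
    have hin : inner ℝ y x = ∑ j, x j * y j := by
      rw [PiLp.inner_apply]
      simp
    rw [modph, smul_eq_mul, ← mul_assoc, ← mul_assoc, ← Complex.exp_add, ← Complex.exp_add, inner_smul_right, hin]
    congr 2
    have hs : ((Real.sin t : ℝ) : ℂ) ≠ 0 := by exact_mod_cast ht.ne'
    have he : (ε : ℂ) ≠ 0 := by exact_mod_cast hε.ne'
    have hpi : (π : ℂ) ≠ 0 := by exact_mod_cast pi_ne_zero
    generalize (∑ j, x j * y j) = S
    generalize Real.sin t = sn at *
    generalize Real.cos t = cs at *
    push_cast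
    field_simp
    ring
  unfold Uprop
  simp_rw [hgint]
  rw [integral_const_mul, ← Real.fourierInv_eq', norm_mul, norm_mul, norm_mul, Complex.norm_exp_ofReal_mul_I, one_mul]
  have e1 : ‖Complex.exp (-Complex.I * (n : ℂ) * (π : ℂ) / 4)‖ = 1 := by
    rw [show -Complex.I * (n : ℂ) * (π : ℂ) / 4 = ((-(n : ℝ) * π / 4 : ℝ) : ℂ) * Complex.I by push_cast; ring,
      Complex.norm_exp_ofReal_mul_I]
  rw [e1, one_mul]
  congr 1
  rw [Complex.norm_cpow_eq_rpow_re_of_pos hl]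
  congr 1
  rw [show (-(n : ℂ) / 2) = ((-(n : ℝ) / 2 : ℝ) : ℂ) by push_cast; ring, Complex.ofReal_re]

lemma lint_Uprop {n : ℕ} {ε t r : ℝ} (hr : 0 < r) (hε : 0 < ε) (ht : 0 < Real.sin t) {φ : Rn n → ℂ} (hφ : Measurable φ) :
    ∫⁻ x, ENNReal.ofReal (‖Uprop n ε t φ x‖ ^ r) =
      ENNReal.ofReal ((2 * π * ε * Real.sin t) ^ (-(r * ((n : ℝ) * (1 / 2 - 1 / r))))) *
        ∫⁻ w, ENNReal.ofReal (‖Gs φ (Real.cos t / (2 * π * ε * Real.sin t)) w‖ ^ r) := by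
  have hl : 0 < 2 * π * ε * Real.sin t := by positivity
  simp_rw [norm_Uprop hε ht]
  set l := 2 * π * ε * Real.sin t with hl'
  set s := Real.cos t / l with hs
  have hmG : Measurable (Gs φ s) := (meas_Gs hφ).of_uncurry_left (f := Gs φ)
  have h1 : ∀ x : Rn n, ENNReal.ofReal ((l ^ (-(n : ℝ) / 2) * ‖Gs φ s (-l⁻¹ • x)‖) ^ r) =
      ENNReal.ofReal ((l ^ (-(n : ℝ) / 2)) ^ r) * ENNReal.ofReal (‖Gs φ s (-l⁻¹ • x)‖ ^ r) := by
    intro x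
    rw [mul_rpow (by positivity) (norm_nonneg _), ENNReal.ofReal_mul (by positivity)]
  simp_rw [h1]
  rw [lintegral_const_mul' _ _ ENNReal.ofReal_ne_top,
    lint_smul (c := -l⁻¹) (g := fun w => ENNReal.ofReal (‖Gs φ s w‖ ^ r)) (by simpa using hl.ne') (by fun_prop), ← mul_assoc,
    ← ENNReal.ofReal_mul (by positivity)]
  congr 2
  rw [abs_inv, abs_pow, abs_neg, abs_inv, abs_of_pos hl, inv_pow, inv_inv, ← rpow_mul hl.le, ← rpow_natCast, ← rpow_add hl]
  congr 1
  field_simp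
  ring

lemma eLpNorm_eq_lint {α : Type*} [MeasurableSpace α] (μ : Measure α) {r : ℝ} (hr : 0 < r) (f : α → ℂ) :
    eLpNorm f (ENNReal.ofReal r) μ = (∫⁻ x, ENNReal.ofReal (‖f x‖ ^ r) ∂μ) ^ (1 / r) := by
  rw [eLpNorm_eq_lintegral_rpow_enorm_toReal (by simpa using hr) ENNReal.ofReal_ne_top, ENNReal.toReal_ofReal hr.le]
  congr 2
  ext x
  rw [← ofReal_norm, ENNReal.ofReal_rpow_of_nonneg (norm_nonneg _) hr.le]

lemma enorm_toReal_le (x : ℝ≥0∞) : ‖x.toReal‖ₑ ≤ x := by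
  rw [Real.enorm_eq_ofReal ENNReal.toReal_nonneg]
  exact ENNReal.ofReal_toReal_le

lemma strich_Uprop {n : ℕ} {r δ : ℝ} (hr : 2 < r)
    (hδ : δ = (n : ℝ) * (1 / 2 - 1 / r)) (hδ0 : 0 < δ) (hδ1 : δ < 1) {a b : ℝ} (ha : 0 < a) (hb : b < π) :
    ∃ C : ℝ, 0 < C ∧ ∀ ε : ℝ, 0 < ε → ∀ (φ : Rn n → ℂ), Measurable φ → Integrable φ → ∀ A1 : ℝ, 0 ≤ A1 →
      ∫⁻ y, ENNReal.ofReal (‖φ y‖ ^ 2) ≤ ENNReal.ofReal A1 →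
      ENNReal.ofReal ε * ∫⁻ t in Set.Icc a b, eLpNorm (Uprop n ε t φ) (ENNReal.ofReal r) volume ^ (2 / δ)
        ≤ ENNReal.ofReal ((C * A1) ^ (1 / δ)) := by
  obtain ⟨C, hC, h⟩ := strich (V := Rn n) hr (by rw [finrank_euclideanSpace_fin]; exact hδ) hδ0 hδ1 rfl
  refine ⟨C, hC, ?_⟩
  intro ε hε φ hφ hφi A1 hA1 hφ2
  have hr0 : 0 < r := by linarith
  have h0 := h φ hφ hφi A1 hA1 hφ2
  set N : ℝ → ℝ≥0∞ := fun s => (∫⁻ w, ENNReal.ofReal (‖Gs φ s w‖ ^ r)) ^ (2 / δ / r) with hN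
  have hsin : ∀ t ∈ Set.Icc a b, 0 < Real.sin t := fun t ht =>
    Real.sin_pos_of_pos_of_lt_pi (by linarith [ht.1]) (by linarith [ht.2])
  set f : ℝ → ℝ := fun t => Real.cos t / (2 * π * ε * Real.sin t) with hf
  set f' : ℝ → ℝ := fun t => -(2 * π * ε * (2 * π * ε * Real.sin t) ^ (-2 : ℝ)) with hf'
  have hder : ∀ t ∈ Set.Icc a b, HasDerivWithinAt f (f' t) (Set.Icc a b) t := by
    intro t ht
    have hs := hsin t ht
    have := ((Real.hasDerivAt_cos t).div ((Real.hasDerivAt_sin t).const_mul (2 * π * ε)) (by positivity))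
    refine (this.congr_deriv ?_).hasDerivWithinAt
    simp only [hf']
    rw [rpow_neg (by positivity), rpow_two]
    field_simp
    linarith [Real.sin_sq_add_cos_sq t]
  have hinj : Set.InjOn f (Set.Icc a b) := by
    intro t ht t' ht' heq
    have hs := hsin t ht
    have hs' := hsin t' ht'
    simp only [hf] at heq
    rw [div_eq_div_iff (by positivity) (by positivity)] at heq
    have h2 : 2 * π * ε * (Real.sin t' * Real.cos t - Real.cos t' * Real.sin t) = 0 := by linarith
    have h3 : Real.sin (t' - t) = 0 := by
      rw [Real.sin_sub]
      exact (mul_eq_zero.1 h2).resolve_left (by positivity)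
    have := (Real.sin_eq_zero_iff_of_lt_of_lt (by linarith [ht.1, ht.2, ht'.1, ht'.2]) (by linarith [ht.1, ht.2, ht'.1, ht'.2])).1 h3
    linarith
  have hcv := lintegral_image_eq_lintegral_abs_deriv_mul measurableSet_Icc hder hinj N
  have hpt : ∀ t ∈ Set.Icc a b, ENNReal.ofReal ε * eLpNorm (Uprop n ε t φ) (ENNReal.ofReal r) volume ^ (2 / δ) ≤
      ENNReal.ofReal |f' t| * N (f t) := by
    intro t ht
    have hs := hsin t ht
    have hl : 0 < 2 * π * ε * Real.sin t := by positivity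
    rw [eLpNorm_eq_lint volume hr0, lint_Uprop hr0 hε hs hφ, ← ENNReal.rpow_mul, ENNReal.mul_rpow_of_nonneg _ _ (by positivity),
      ENNReal.ofReal_rpow_of_nonneg (by positivity) (by positivity), ← mul_assoc, ← ENNReal.ofReal_mul hε.le, ← rpow_mul hl.le]
    have e1 : (1 / r * (2 / δ)) = 2 / δ / r := by field_simp
    have e2 : -(r * ((n : ℝ) * (1 / 2 - 1 / r))) * (1 / r * (2 / δ)) = -2 := by
      rw [← hδ]; field_simp
    rw [e2, e1]
    simp only [hN, hf, hf']
    gcongr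
    rw [abs_neg, abs_of_pos (by positivity)]
    have h3 : 1 ≤ 2 * π := by linarith [Real.pi_gt_three]
    have : 0 < (2 * π * ε * Real.sin t) ^ (-2 : ℝ) := by positivity
    gcongr
    nlinarith
  rw [← lintegral_const_mul' _ _ ENNReal.ofReal_ne_top]
  calc _ ≤ ∫⁻ t in Set.Icc a b, ENNReal.ofReal |f' t| * N (f t) := setLIntegral_mono' measurableSet_Icc hpt
    _ = ∫⁻ s in f '' Set.Icc a b, N s := hcv.symm
    _ ≤ ∫⁻ s, N s := setLIntegral_le_lintegral _ _
    _ ≤ _ := h0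

end TransferPart

/-- scaled homogeneous Strichartz estimate for the harmonic-oscillator
propagator U^ε(t) (defined by Mehler's formula): for every admissible pair (q,r)
(2 ≤ r < 2n/(n−2), r < ∞ if n = 2, and 2/q = δ(r) = n(1/2 − 1/r)) and every compact
interval I = [a,b] ⊂ (0,π), there is C independent of ε ∈ (0,1] with
ε^{1/q} ‖ ‖U^ε(t)φ‖_{L^r} ‖_{L^q_t(I)} ≤ C ‖φ‖_{L²}. The time exponent q is taken in
ℝ≥0∞ so that the pair (∞,2) is included. -/
theorem stmt4 (n : ℕ) (hn : 2 ≤ n) (q : ℝ≥0∞) (r : ℝ) (hr : 2 ≤ r)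
    (hr' : 2 < n → r < 2 * n / ((n : ℝ) - 2))
    (hq : 2 / q = ENNReal.ofReal ((n : ℝ) * (1 / 2 - 1 / r)))
    (a b : ℝ) (ha : 0 < a) (hab : a ≤ b) (hb : b < π) :
    ∃ C : ℝ, 0 < C ∧ ∀ ε ∈ Set.Ioc (0 : ℝ) 1, ∀ φ : SchwartzMap (Rn n) ℂ,
      ENNReal.ofReal ε ^ (1 / q).toReal *
        eLpNorm (fun t => (eLpNorm (Uprop n ε t ⇑φ) (ENNReal.ofReal r) volume).toReal)
          q (volume.restrict (Set.Icc a b))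
      ≤ ENNReal.ofReal C * eLpNorm (⇑φ) 2 volume := by
  have hr0 : 0 < r := by linarith
  have hπ := Real.pi_pos
  -- L2 norm of the datum
  have hA : ∀ φ : SchwartzMap (Rn n) ℂ, Integrable fun y => ‖φ y‖ ^ 2 := fun φ =>
    (φ.memLp 2 volume).integrable_norm_pow two_ne_zero
  have hA2 : ∀ φ : SchwartzMap (Rn n) ℂ, ∫⁻ y, ENNReal.ofReal (‖φ y‖ ^ 2) = ENNReal.ofReal (∫ y, ‖φ y‖ ^ 2) := fun φ =>
    (ofReal_integral_eq_lintegral_ofReal (hA φ) (Eventually.of_forall fun y => by positivity)).symm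
  have hφ2 : ∀ φ : SchwartzMap (Rn n) ℂ, eLpNorm (⇑φ) 2 volume = (∫⁻ y, ENNReal.ofReal (‖φ y‖ ^ 2)) ^ (1 / 2 : ℝ) := by
    intro φ
    have := eLpNorm_eq_lint (volume : Measure (Rn n)) two_pos (⇑φ)
    simpa using this
  rcases hr.eq_or_lt with h2 | hr2
  · subst h2
    have hq' : q = ⊤ := by
      norm_num at hq
      simpa using hq
    subst hq'
    refine ⟨1, one_pos, ?_⟩
    intro ε hε φ
    have hφm : Measurable (⇑φ) := φ.continuous.measurable
    have hφi : Integrable (⇑φ) := φ.integrable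
    simp only [ENNReal.div_top, ENNReal.toReal_zero, ENNReal.rpow_zero, one_mul, ENNReal.ofReal_one]
    rw [eLpNorm_exponent_top]
    apply eLpNormEssSup_le_of_ae_enorm_bound
    refine (ae_restrict_iff' measurableSet_Icc).2 (Eventually.of_forall fun t ht => ?_)
    have hs : 0 < Real.sin t := Real.sin_pos_of_pos_of_lt_pi (by linarith [ht.1]) (by linarith [ht.2])
    refine (enorm_toReal_le _).trans ?_
    rw [eLpNorm_eq_lint volume two_pos, lint_Uprop two_pos hε.1 hs hφm, hφ2]
    apply ENNReal.rpow_le_rpow _ (by norm_num)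
    rw [sub_self, mul_zero, mul_zero, neg_zero, rpow_zero, ENNReal.ofReal_one, one_mul]
    simp only [rpow_two]
    refine (plancherel_inv_le (int_modph hφm hφi _) (meas_modph' hφm _)).trans (le_of_eq ?_)
    simp_rw [norm_modph]
  · set δ : ℝ := (n : ℝ) * (1 / 2 - 1 / r) with hδ
    have hn0 : (2 : ℝ) ≤ n := by exact_mod_cast hn
    have hδ0 : 0 < δ := by
      have : 1 / r < 1 / 2 := one_div_lt_one_div_of_lt two_pos hr2
      have h3 : 0 < 1 / 2 - 1 / r := by linarith
      rw [hδ]; positivity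
    have hδ1 : δ < 1 := by
      rcases hn.eq_or_lt with h | h
      · rw [hδ, ← h]
        have : 0 < 1 / r := by positivity
        push_cast; linarith
      · have h1 := hr' h
        have h2 : (2 : ℝ) < n := by exact_mod_cast h
        rw [lt_div_iff₀ (by linarith)] at h1
        have e : δ * (2 * r) = n * (r - 2) := by rw [hδ]; field_simp
        by_contra hcon
        rw [not_lt] at hcon
        nlinarith
    obtain ⟨C, hC, h⟩ := strich_Uprop (n := n) hr2 hδ hδ0 hδ1 ha hb
    have hq' : q = ENNReal.ofReal (2 / δ) := by
      rw [ENNReal.ofReal_div_of_pos hδ0, ← hq]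
      have hq0 : q ≠ 0 := by
        rintro rfl
        rw [ENNReal.div_zero two_ne_zero] at hq
        exact ENNReal.ofReal_ne_top hq.symm
      have hqt : q ≠ ⊤ := by
        rintro rfl
        rw [ENNReal.div_top] at hq
        exact absurd (ENNReal.ofReal_eq_zero.1 hq.symm) (not_le.2 hδ0)
      rw [ENNReal.ofReal_ofNat, ENNReal.div_eq_inv_mul (b := 2 / q), ENNReal.inv_div (Or.inr (by simp)) (Or.inr (by simp)),
        ENNReal.div_mul_cancel (by simp) (by simp)]
    have hQ : 0 < 2 / δ := by positivity
    have hqr : q.toReal = 2 / δ := by rw [hq', ENNReal.toReal_ofReal hQ.le]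
    have hq1 : (1 / q).toReal = 1 / (2 / δ) := by rw [ENNReal.toReal_div, hqr]; simp
    have hq0 : q ≠ 0 := by rw [hq']; simpa using hQ
    have hqt : q ≠ ⊤ := by rw [hq']; exact ENNReal.ofReal_ne_top
    refine ⟨C ^ (1 / 2 : ℝ), by positivity, ?_⟩
    intro ε hε φ
    have hφm : Measurable (⇑φ) := φ.continuous.measurable
    have hφi : Integrable (⇑φ) := φ.integrable
    have hA0 : 0 ≤ ∫ y, ‖φ y‖ ^ 2 := integral_nonneg fun y => by positivity
    have hmain := h ε hε.1 (⇑φ) hφm hφi _ hA0 (hA2 φ).le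
    rw [eLpNorm_eq_lintegral_rpow_enorm_toReal hq0 hqt, hq1, hqr, ← ENNReal.mul_rpow_of_nonneg _ _ (by positivity)]
    calc _ ≤ (ENNReal.ofReal ((C * ∫ y, ‖φ y‖ ^ 2) ^ (1 / δ))) ^ (1 / (2 / δ)) := by
          apply ENNReal.rpow_le_rpow _ (by positivity)
          refine le_trans ?_ hmain
          gcongr with t
          exact enorm_toReal_le _
      _ = _ := by
          rw [hφ2, hA2, ENNReal.ofReal_rpow_of_nonneg hA0 (by norm_num), ← ENNReal.ofReal_mul (by positivity),
            ENNReal.ofReal_rpow_of_nonneg (by positivity) (by positivity), ← rpow_mul (by positivity),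
            ← mul_rpow hC.le hA0]
          congr 2
          field_simp

end
end
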